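/- Fix (α, β, θ) ∈ (0,1)³ with α < η̃^hyp_θ(β). Then as p → ∞: (i) if 0 < β < 1/2, then Err(T̂_*^{(sa)}) → 0; (ii) if 1/2 < β < 1, then Err(T̂^{(hc)}) → 0. -/

import Mathlib

open MeasureTheory ProbabilityTheory Filter
open scoped ENNReal NNReal Classical BigOperators

namespace ARWPaper

/-- `n = ⌈p^θ⌉`. -/
noncomputable def nDim (p : ℕ) (θ : ℝ) : ℕ := ⌈(p : ℝ) ^ θ⌉₊

/-- Law of a single class label: uniform on `{-1, 1}`. -/
noncomputable def signLaw : Measure ℝ :=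
  (1 / 2 : ℝ≥0∞) • Measure.dirac (1 : ℝ) + (1 / 2 : ℝ≥0∞) • Measure.dirac (-1 : ℝ)

/-- Law of a single coordinate of `μ`: `τ` w.p. `ε`, `0` w.p. `1 - ε`. -/
noncomputable def muLaw (ε τ : ℝ) : Measure ℝ :=
  ENNReal.ofReal (1 - ε) • Measure.dirac (0 : ℝ) + ENNReal.ofReal ε • Measure.dirac τ

/-- Standard Gaussian product measure on `ℝ^n`. -/
noncomputable def gaussPi (n : ℕ) : Measure (Fin n → ℝ) :=
  Measure.pi fun _ => gaussianReal 0 1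

/-- Law of the noise matrix `Z` (i.i.d. `N(0,1)` entries, rows indexed by `Fin n`). -/
noncomputable def noiseLaw (n p : ℕ) : Measure (Fin n → Fin p → ℝ) :=
  Measure.pi fun _ => gaussPi p

/-- Sample space for `(ℓ, μ, Z)`. -/
abbrev Omega (n p : ℕ) := (Fin n → ℝ) × (Fin p → ℝ) × (Fin n → Fin p → ℝ)

/-- Joint law of `(ℓ, μ, Z)`. -/
noncomputable def jointLaw (n p : ℕ) (ε τ : ℝ) : Measure (Omega n p) :=
  (Measure.pi fun _ : Fin n => signLaw).prod
    ((Measure.pi fun _ : Fin p => muLaw ε τ).prod (noiseLaw n p))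

/-- Data matrix `X = ℓ μ' + Z`. -/
def dataMap {n p : ℕ} (ω : Omega n p) : Fin n → Fin p → ℝ :=
  fun i j => ω.1 i * ω.2.1 j + ω.2.2 i j

/-- Hamming clustering error of a clustering procedure `ell`, where the observed data
matrix is `D ω`. -/
noncomputable def hammingClu (n p : ℕ) (ε τ : ℝ)
    (D : Omega n p → Fin n → Fin p → ℝ)
    (ell : (Fin n → Fin p → ℝ) → Fin n → ℝ) : ℝ :=
  (n : ℝ)⁻¹ * min
    (∑ i : Fin n, ((jointLaw n p ε τ) {ω | ell (D ω) i ≠ ω.1 i}).toReal)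
    (∑ i : Fin n, ((jointLaw n p ε τ) {ω | ell (D ω) i ≠ -ω.1 i}).toReal)

/-- Hamming error for signal (support) recovery. -/
noncomputable def hammingSig (n p : ℕ) (ε τ : ℝ)
    (D : Omega n p → Fin n → Fin p → ℝ)
    (S : (Fin n → Fin p → ℝ) → Finset (Fin p)) : ℝ :=
  ((p : ℝ) * ε)⁻¹ * ∑ j : Fin p,
    (((jointLaw n p ε τ) {ω | ω.2.1 j = 0 ∧ j ∈ S (D ω)}).toReal +
      ((jointLaw n p ε τ) {ω | ω.2.1 j ≠ 0 ∧ j ∉ S (D ω)}).toReal)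

/-- Sum of type I and type II testing errors of the rejection region `R`. -/
noncomputable def testErr (n p : ℕ) (ε τ : ℝ)
    (R : Set (Fin n → Fin p → ℝ)) : ℝ :=
  ((noiseLaw n p) R).toReal + ((jointLaw n p ε τ) {ω | dataMap ω ∉ R}).toReal

/-- Statistical boundary for clustering. -/
noncomputable def etaClu (θ β : ℝ) : ℝ :=
  if β < (1 - θ) / 2 then (1 - 2 * β) / 2
  else if β < 1 - θ then θ / 2
  else (1 - β) / 2

/-- CTUB boundary for clustering. -/
noncomputable def etaCluT (θ β : ℝ) : ℝ :=
  if β < (1 - θ) / 2 then (1 - 2 * β) / 2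
  else if β < 1 / 2 then (1 + θ - 2 * β) / 4
  else if β < 1 - θ / 2 then θ / 4
  else (1 - β) / 2

/-- Statistical boundary for signal recovery. -/
noncomputable def etaSig (θ β : ℝ) : ℝ :=
  if β < 1 - θ then θ / 2 else (1 + θ - β) / 4

/-- CTUB boundary for signal recovery. -/
noncomputable def etaSigT (θ β : ℝ) : ℝ :=
  if β < (1 - θ) / 2 then θ / 2
  else if β < 1 / 2 then (1 + θ - 2 * β) / 4
  else θ / 4

noncomputable def etaHyp1 (θ β : ℝ) : ℝ := (2 + θ - 4 * β) / 4
noncomputable def etaHyp2 (θ β : ℝ) : ℝ := min (θ / 2) ((1 + θ - β) / 4)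
noncomputable def etaHyp (θ β : ℝ) : ℝ := max (etaHyp1 θ β) (etaHyp2 θ β)
noncomputable def etaHypT (θ β : ℝ) : ℝ := max (etaHyp1 θ β) (θ / 4)

/-- Standard phase function `ρ*`. -/
noncomputable def rhoStar (b : ℝ) : ℝ :=
  if b < 3 / 4 then b - 1 / 2 else (1 - Real.sqrt (1 - b)) ^ 2

/-- Phase function for IF-PCA. -/
noncomputable def rhoStarTheta (θ β : ℝ) : ℝ :=
  (1 - θ) * rhoStar (1 / 2 + (β - 1 / 2) / (1 - θ))

/-- Euclidean norm of a vector. -/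
noncomputable def l2 {n : ℕ} (v : Fin n → ℝ) : ℝ := Real.sqrt (∑ i, v i ^ 2)

/-- Entrywise sup-norm of a vector. -/
noncomputable def linf {n : ℕ} (v : Fin n → ℝ) : ℝ := ⨆ i, |v i|

/-- `cos(x, y) = |⟨x/‖x‖, y/‖y‖⟩|`. -/
noncomputable def cosv {n : ℕ} (x y : Fin n → ℝ) : ℝ :=
  |∑ i, x i * y i| / (l2 x * l2 y)

/-- Spectral (operator) norm of a matrix. -/
noncomputable def specNorm {m k : ℕ} (A : Matrix (Fin m) (Fin k) ℝ) : ℝ :=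
  sSup ((fun v => l2 (A.mulVec v)) '' {v | l2 v ≤ 1})

/-- Simple Aggregation clustering: entrywise sign of the sum of all columns. -/
noncomputable def ellSimpleAgg {n p : ℕ} (X : Fin n → Fin p → ℝ) : Fin n → ℝ :=
  fun i => Real.sign (∑ j, X i j)

/-- `S` picks, for every data matrix, a size-`N` subset maximizing `‖∑_{j ∈ S} x_j‖₁`. -/
def IsSparseAggMaximizer {n p : ℕ} (N : ℕ)
    (S : (Fin n → Fin p → ℝ) → Finset (Fin p)) : Prop :=
  ∀ X, (S X).card = N ∧
    ∀ T : Finset (Fin p), T.card = N →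
      ∑ i, |∑ j ∈ T, X i j| ≤ ∑ i, |∑ j ∈ S X, X i j|

/-- Sparse Aggregation clustering. -/
noncomputable def ellSparseAgg {n p : ℕ}
    (S : (Fin n → Fin p → ℝ) → Finset (Fin p)) (X : Fin n → Fin p → ℝ) :
    Fin n → ℝ :=
  fun i => Real.sign (∑ j ∈ S X, X i j)

/-- Gram matrix `X X'`. -/
def gram {n p : ℕ} (X : Fin n → Fin p → ℝ) : Matrix (Fin n) (Fin n) ℝ :=
  Matrix.of fun i i' => ∑ j, X i j * X i' j

/-- `ξ` is a unit eigenvector of `A` associated with its largest eigenvalue. -/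
def IsTopEigenvector {n : ℕ} (A : Matrix (Fin n) (Fin n) ℝ) (ξ : Fin n → ℝ) : Prop :=
  (∑ i, ξ i ^ 2) = 1 ∧
    ∃ lam : ℝ, A.mulVec ξ = lam • ξ ∧
      ∀ (lam' : ℝ) (v : Fin n → ℝ), v ≠ 0 → A.mulVec v = lam' • v → lam' ≤ lam

/-- χ²-screening: the set of selected features. -/
noncomputable def chiSel {n p : ℕ} (q : ℝ) (X : Fin n → Fin p → ℝ) : Finset (Fin p) :=
  Finset.univ.filter fun j =>
    Real.sqrt (2 * q * Real.log p) ≤ ((∑ i, X i j ^ 2) - n) / Real.sqrt (2 * n)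

/-- Post-selection Gram matrix `X^{(q)} (X^{(q)})'`. -/
noncomputable def gramSel {n p : ℕ} (q : ℝ) (X : Fin n → Fin p → ℝ) :
    Matrix (Fin n) (Fin n) ℝ :=
  Matrix.of fun i i' => ∑ j ∈ chiSel q X, X i j * X i' j

/-- IF-PCA calibration `τ_p* = p^{-θ/4} (4 r log p)^{1/4}`. -/
noncomputable def tauStar (p : ℕ) (θ r : ℝ) : ℝ :=
  (p : ℝ) ^ (-(θ / 4)) * (4 * r * Real.log p) ^ ((1 : ℝ) / 4)

/-- The ideal threshold `q*` of IF-PCA in the Region of Possibility. -/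
noncomputable def qStar (θ β r : ℝ) : ℝ :=
  if (β - θ / 2) / 3 < r then (β - θ / 2 + r) ^ 2 / (4 * r) else 4 * r

/-- Support of `μ`. -/
noncomputable def suppSet {p : ℕ} (μ : Fin p → ℝ) : Finset (Fin p) :=
  Finset.univ.filter fun j => μ j ≠ 0

/-- The event `D_p`: `| |S(μ)| - p ε_p | ≤ √(6 p ε_p log p)` with `ε_p = p^{-β}`. -/
def inDp (β : ℝ) {p : ℕ} (μ : Fin p → ℝ) : Prop :=
  |((suppSet μ).card : ℝ) - (p : ℝ) * (p : ℝ) ^ (-β)| ≤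
    Real.sqrt (6 * ((p : ℝ) * (p : ℝ) ^ (-β)) * Real.log p)

/-- Selection threshold `n + 2√(q n log p)` for the squared column norm. -/
noncomputable def thresh (p n : ℕ) (q : ℝ) : ℝ :=
  (n : ℝ) + 2 * Real.sqrt (q * n * Real.log p)

/-- `π₀ = P(‖z‖² > n + 2√(q n log p))`, `z ~ N(0, I_n)`. -/
noncomputable def pi0 (p n : ℕ) (q : ℝ) : ℝ :=
  ((gaussPi n) {z | thresh p n q < ∑ i, z i ^ 2}).toReal

/-- `π₁ = P(‖z + τ ℓ‖² > n + 2√(q n log p))`, `z ~ N(0, I_n)`. -/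
noncomputable def pi1 (p : ℕ) {n : ℕ} (q τ : ℝ) (ℓ : Fin n → ℝ) : ℝ :=
  ((gaussPi n) {z | thresh p n q < ∑ i, (z i + τ * ℓ i) ^ 2}).toReal

/-- Expected number of selected useless features (`s = |S(μ)|`). -/
noncomputable def m0q (p n : ℕ) (q : ℝ) (s : ℕ) : ℝ := ((p : ℝ) - s) * pi0 p n q

/-- Expected number of selected useful features. -/
noncomputable def m1q (p : ℕ) {n : ℕ} (q τ : ℝ) (ℓ : Fin n → ℝ) (s : ℕ) : ℝ :=
  (s : ℝ) * pi1 p q τ ℓ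

/-- `m^{(q)}`. -/
noncomputable def mq (p : ℕ) {n : ℕ} (q τ : ℝ) (ℓ : Fin n → ℝ) (s : ℕ) : ℝ :=
  m0q p n q s + m1q p q τ ℓ s

/-- `m_*^{(q)}`. -/
noncomputable def mstarq (p : ℕ) {n : ℕ} (q τ : ℝ) (ℓ : Fin n → ℝ) (s : ℕ) : ℝ :=
  ((p : ℝ) - s) * (n : ℝ)⁻¹ *
      (∫ z in {z : Fin n → ℝ | thresh p n q < ∑ i, z i ^ 2}, (∑ i, z i ^ 2) ∂gaussPi n) +
    (s : ℝ) * (n : ℝ)⁻¹ *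
      (∫ z in {z : Fin n → ℝ | thresh p n q < ∑ i, (z i + τ * ℓ i) ^ 2},
        (∑ i, z i ^ 2) ∂gaussPi n)

/-- The threshold `q̃(β, θ, r)` separating the "fat" and "skinny" cases. -/
noncomputable def qTilde (β θ r : ℝ) : ℝ :=
  if β < 1 - θ then max (1 - θ) ((Real.sqrt (1 - β - θ) + Real.sqrt r) ^ 2)
  else 1 - θ

/-- The set of features selected by χ²-screening, in terms of `(ℓ, μ, Z)`. -/
noncomputable def selSet {n p : ℕ} (q : ℝ) (ℓ : Fin n → ℝ) (μ : Fin p → ℝ)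
    (Z : Fin n → Fin p → ℝ) : Finset (Fin p) :=
  chiSel q fun i j => ℓ i * μ j + Z i j

/-- `Z^{(q)} (Z^{(q)})'`. -/
noncomputable def gramZq {n p : ℕ} (q : ℝ) (ℓ : Fin n → ℝ) (μ : Fin p → ℝ)
    (Z : Fin n → Fin p → ℝ) : Matrix (Fin n) (Fin n) ℝ :=
  Matrix.of fun i i' => ∑ j ∈ selSet q ℓ μ Z, Z i j * Z i' j

/-- `X^{(q)} (X^{(q)})'`. -/
noncomputable def gramXq {n p : ℕ} (q : ℝ) (ℓ : Fin n → ℝ) (μ : Fin p → ℝ)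
    (Z : Fin n → Fin p → ℝ) : Matrix (Fin n) (Fin n) ℝ :=
  Matrix.of fun i i' =>
    ∑ j ∈ selSet q ℓ μ Z, (ℓ i * μ j + Z i j) * (ℓ i' * μ j + Z i' j)

/-- The matrix `ℓ (μ^{(q)})' (Z^{(q)})' + Z^{(q)} μ^{(q)} ℓ'`. -/
noncomputable def crossMat {n p : ℕ} (q : ℝ) (ℓ : Fin n → ℝ) (μ : Fin p → ℝ)
    (Z : Fin n → Fin p → ℝ) : Matrix (Fin n) (Fin n) ℝ :=
  Matrix.of fun i i' =>
    ℓ i * (∑ j ∈ selSet q ℓ μ Z, Z i' j * μ j) +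
      (∑ j ∈ selSet q ℓ μ Z, Z i j * μ j) * ℓ i'

/-- Colored-noise data matrix `X = ℓ μ' + A Z B`. -/
noncomputable def dataColored {n p : ℕ} (A : Matrix (Fin n) (Fin n) ℝ)
    (B : Matrix (Fin p) (Fin p) ℝ) (ω : Omega n p) : Fin n → Fin p → ℝ :=
  fun i j => ω.1 i * ω.2.1 j + (A * Matrix.of ω.2.2 * B) i j

/-- Colored-noise data matrix `X = ℓ μ' + Z B`. -/
noncomputable def dataColoredB {n p : ℕ} (B : Matrix (Fin p) (Fin p) ℝ)
    (ω : Omega n p) : Fin n → Fin p → ℝ :=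
  fun i j => ω.1 i * ω.2.1 j + (Matrix.of ω.2.2 * B) i j

/-- `y_*^{(sa)} = n^{-1/2} X' ℓ̂_*^{(sa)}`. -/
noncomputable def ySA {n p : ℕ} (X : Fin n → Fin p → ℝ) : Fin p → ℝ :=
  fun j => (Real.sqrt n)⁻¹ * ∑ i, X i j * ellSimpleAgg X i

/-- `Ŝ_*^{(sa)}`: thresholding `y_*^{(sa)}` at the universal threshold. -/
noncomputable def ShatSA {n p : ℕ} (X : Fin n → Fin p → ℝ) : Finset (Fin p) :=
  Finset.univ.filter fun j => Real.sqrt (2 * Real.log p) ≤ |ySA X j|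

/-- `y_*^{(if)} = n^{-1/2} X' sgn(ξ)` for a given vector `ξ`. -/
noncomputable def yIF {n p : ℕ} (ξ : Fin n → ℝ) (X : Fin n → Fin p → ℝ) : Fin p → ℝ :=
  fun j => (Real.sqrt n)⁻¹ * ∑ i, X i j * Real.sign (ξ i)

/-- `Ŝ_*^{(if)}`: thresholding `y_*^{(if)}` at the universal threshold. -/
noncomputable def ShatIF {n p : ℕ} (ξ : Fin n → ℝ) (X : Fin n → Fin p → ℝ) : Finset (Fin p) :=
  Finset.univ.filter fun j => Real.sqrt (2 * Real.log p) ≤ |yIF ξ X j|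

/-- Rejection region of the Simple Aggregation test `T̂_*^{(sa)}`. -/
noncomputable def rejSA {n p : ℕ} : Set (Fin n → Fin p → ℝ) :=
  {X | 2 * Real.sqrt (2 * Real.log p) ≤
    ((p : ℝ) * (∑ i, ((p : ℝ)⁻¹ * ∑ j, X i j) ^ 2) - n) / Real.sqrt (2 * n)}

/-- Rejection region of the Sparse Aggregation test `T̂_N^{(sa)}`. -/
noncomputable def rejSparse {n p : ℕ} (N : ℕ)
    (S : (Fin n → Fin p → ℝ) → Finset (Fin p)) : Set (Fin n → Fin p → ℝ) :=
  {X | Real.sqrt (2 / Real.pi) * n + Real.sqrt (2 * n * (N + 2) * Real.log p) ≤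
    (Real.sqrt N)⁻¹ * ∑ i, |∑ j ∈ S X, X i j|}

/-- χ² P-value of feature `j`. -/
noncomputable def pvalue {n p : ℕ} (X : Fin n → Fin p → ℝ) (j : Fin p) : ℝ :=
  ((gaussPi n) {z | (∑ i, X i j ^ 2) ≤ ∑ i, z i ^ 2}).toReal

/-- Higher Criticism statistic. -/
noncomputable def HCstat {n p : ℕ} (X : Fin n → Fin p → ℝ) : ℝ :=
  sSup {h : ℝ | ∃ i : Fin p, 2 * (i.val + 1) ≤ p ∧
    h = Real.sqrt p * (((i.val : ℝ) + 1) / p - pvalue X (Tuple.sort (pvalue X) i)) /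
      Real.sqrt (pvalue X (Tuple.sort (pvalue X) i) *
        (1 - pvalue X (Tuple.sort (pvalue X) i)))}

/-- Rejection region of the Higher Criticism test. -/
noncomputable def rejHC {n p : ℕ} : Set (Fin n → Fin p → ℝ) :=
  {X | 2 * Real.sqrt (2 * Real.log (Real.log p)) ≤ HCstat X}

/-- Lebesgue measure on the space of `n × p` matrices. -/
noncomputable def lebPi (n p : ℕ) : Measure (Fin n → Fin p → ℝ) :=
  Measure.pi fun _ : Fin n => Measure.pi fun _ : Fin p => (volume : Measure ℝ)

/-- Law of `X` in Experiment 1 (`X = ℓ μ' + c_p Z`) with `ℓ_i` forced to be `s`. -/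
noncomputable def condLaw1 (n p : ℕ) (ε τ cp : ℝ) (i : Fin n) (s : ℝ) :
    Measure (Fin n → Fin p → ℝ) :=
  (jointLaw n p ε τ).map fun ω => fun i' j =>
    Function.update ω.1 i s i' * ω.2.1 j + cp * ω.2.2 i' j

/-- Law of `X` in Experiment 2 (`X = ℓ μ' + c_p Z + W`) with `ℓ_i` forced to be `s`,
where `W ~ ν` is independent of `(ℓ, μ, Z)`. -/
noncomputable def condLaw2 (n p : ℕ) (ε τ cp : ℝ)
    (ν : Measure (Fin n → Fin p → ℝ)) (i : Fin n) (s : ℝ) :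
    Measure (Fin n → Fin p → ℝ) :=
  ((jointLaw n p ε τ).prod ν).map fun ωw => fun i' j =>
    Function.update ωw.1.1 i s i' * ωw.1.2.1 j + cp * ωw.1.2.2 i' j + ωw.2 i' j

end ARWPaper

namespace ARWPaper

section

variable {p : ℕ}

/-- The compensated indicator of `{r ≤ t}`, normalised so as to be a martingale in `t`. -/
noncomputable def compInd (ν : Measure ℝ) (t r : ℝ) : ℝ :=
  if r ≤ t then 1 else -(ν.real (Set.Iic t) / (1 - ν.real (Set.Iic t)))

lemma measurable_ite_le_const (t a b : ℝ) : Measurable fun r : ℝ => if r ≤ t then a else b :=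
  Measurable.ite measurableSet_Iic measurable_const measurable_const

lemma measurable_compInd (ν : Measure ℝ) (t : ℝ) : Measurable (compInd ν t) :=
  measurable_ite_le_const _ _ _

lemma integral_ite_le_const (ν : Measure ℝ) [IsProbabilityMeasure ν] (t a b : ℝ) :
    ∫ r, (if r ≤ t then a else b) ∂ν =
      ν.real (Set.Iic t) * a + (1 - ν.real (Set.Iic t)) * b := by
  have h : (fun r : ℝ => if r ≤ t then a else b) =
      fun r => (Set.Iic t).indicator (fun _ => a - b) r + b := by
    ext r
    by_cases hr : r ≤ t <;> simp [hr]
  rw [h, integral_add ((integrable_const _).indicator measurableSet_Iic) (integrable_const _),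
    integral_indicator_const _ measurableSet_Iic]
  simp
  ring

lemma integral_compInd (ν : Measure ℝ) [IsProbabilityMeasure ν] {t : ℝ}
    (ht : ν.real (Set.Iic t) < 1) : ∫ r, compInd ν t r ∂ν = 0 := by
  have h : 1 - ν.real (Set.Iic t) ≠ 0 := by linarith
  simp only [compInd]
  rw [integral_ite_le_const]
  field_simp
  ring

lemma abs_compInd_le (ν : Measure ℝ) (t r : ℝ) :
    |compInd ν t r| ≤ 1 + |ν.real (Set.Iic t) / (1 - ν.real (Set.Iic t))| := by
  unfold compInd
  split_ifs
  · simp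
  · rw [abs_neg]; linarith

lemma integrable_compInd (ν : Measure ℝ) [IsProbabilityMeasure ν] (t : ℝ) :
    Integrable (compInd ν t) ν :=
  Integrable.of_bound (measurable_compInd ν t).aestronglyMeasurable _
    (ae_of_all _ fun r => abs_compInd_le ν t r)

lemma exp_le_one_add_add_sq {x : ℝ} (hx : x ≤ 1) : Real.exp x ≤ 1 + x + x ^ 2 := by
  by_cases h : -1 ≤ x
  · have := abs_le.1 (Real.abs_exp_sub_one_sub_id_le (abs_le.2 ⟨h, hx⟩))
    linarith [this.2]
  · push Not at h
    have : Real.exp x ≤ 1 := Real.exp_le_one_iff.2 (by linarith)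
    nlinarith

lemma integral_exp_compInd_le (ν : Measure ℝ) [IsProbabilityMeasure ν] {t s : ℝ}
    (ht : ν.real (Set.Iic t) < 1) (hs0 : 0 ≤ s) (hs1 : s ≤ 1) :
    ∫ r, Real.exp (s * compInd ν t r) ∂ν ≤
      Real.exp (s ^ 2 * (ν.real (Set.Iic t) / (1 - ν.real (Set.Iic t)))) := by
  set F := ν.real (Set.Iic t) with hF
  have hF0 : 0 ≤ F := measureReal_nonneg
  have h1 : 0 < 1 - F := by linarith
  have e : (fun r => Real.exp (s * compInd ν t r)) =
      fun r => if r ≤ t then Real.exp s else Real.exp (s * -(F / (1 - F))) := by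
    ext r
    unfold compInd
    split_ifs <;> simp [hF]
  rw [e, integral_ite_le_const, ← hF]
  have i1 := exp_le_one_add_add_sq hs1
  have hq : 0 ≤ F / (1 - F) := by positivity
  have i2 := exp_le_one_add_add_sq (x := s * -(F / (1 - F))) (by nlinarith)
  have i3 := Real.add_one_le_exp (s ^ 2 * (F / (1 - F)))
  refine le_trans (add_le_add (mul_le_mul_of_nonneg_left i1 hF0)
    (mul_le_mul_of_nonneg_left i2 h1.le)) (le_trans (le_of_eq ?_) i3)
  field_simp
  ring

lemma integral_mul_compInd_sub (ν : Measure ℝ) [IsProbabilityMeasure ν] {t t' c : ℝ}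
    (htt : t ≤ t') (ht : ν.real (Set.Iic t') < 1) (j : Fin p) (g : (Fin p → ℝ) → ℝ)
    (hg : Measurable g) (hgc : ∀ u : Fin p → ℝ, t < u j → g u = g (Function.update u j c)) :
    ∫ u, g u * (compInd ν t' (u j) - compInd ν t (u j)) ∂(Measure.pi fun _ => ν) = 0 := by
  have ht' : ν.real (Set.Iic t) < 1 :=
    lt_of_le_of_lt (measureReal_mono (Set.Iic_subset_Iic.2 htt)) ht
  have e : (fun u : Fin p → ℝ => g u * (compInd ν t' (u j) - compInd ν t (u j))) =
      fun u => g (Function.update u j c) * (compInd ν t' (u j) - compInd ν t (u j)) := by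
    ext u
    by_cases h : t < u j
    · rw [hgc u h]
    · have h1 : u j ≤ t := not_lt.1 h
      simp [compInd, h1, h1.trans htt]
  rw [e]
  have hind : iIndepFun (fun (i : Fin p) (u : Fin p → ℝ) => u i) (Measure.pi fun _ => ν) :=
    iIndepFun_pi (X := fun _ => id) fun _ => aemeasurable_id
  have h2 := hind.indepFun_finset ({j}ᶜ) {j} disjoint_compl_left fun i => measurable_pi_apply i
  have hφ : Measurable fun v : (({j}ᶜ : Finset (Fin p)) → ℝ) =>
      g fun i => if h : i ∈ ({j}ᶜ : Finset (Fin p)) then v ⟨i, h⟩ else c := by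
    refine hg.comp (measurable_pi_lambda _ fun i => ?_)
    by_cases h : i ∈ ({j}ᶜ : Finset (Fin p))
    · simpa [h] using measurable_pi_apply _
    · simp [h]
  have hψ : Measurable fun v : (({j} : Finset (Fin p)) → ℝ) =>
      compInd ν t' (v ⟨j, by simp⟩) - compInd ν t (v ⟨j, by simp⟩) :=
    ((measurable_compInd ν t').comp (measurable_pi_apply _)).sub
      ((measurable_compInd ν t).comp (measurable_pi_apply _))
  have h3 := h2.comp hφ hψ
  have e2 : ((fun v : (({j}ᶜ : Finset (Fin p)) → ℝ) =>
      g fun i => if h : i ∈ ({j}ᶜ : Finset (Fin p)) then v ⟨i, h⟩ else c) ∘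
      fun (a : Fin p → ℝ) (i : ({j}ᶜ : Finset (Fin p))) => a i) =
      fun u => g (Function.update u j c) := by
    ext u
    simp only [Function.comp]
    congr 1
    ext i
    by_cases h : i = j <;> simp [h]
  have mφ := hφ.comp
    (measurable_pi_lambda (fun (a : Fin p → ℝ) (i : ({j}ᶜ : Finset (Fin p))) => a i)
      fun i => measurable_pi_apply _)
  rw [e2] at h3 mφ
  have mψ : Measurable fun u : Fin p → ℝ => compInd ν t' (u j) - compInd ν t (u j) :=
    ((measurable_compInd ν t').comp (measurable_pi_apply j)).sub
      ((measurable_compInd ν t).comp (measurable_pi_apply j))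
  have h4 := IndepFun.integral_fun_mul_eq_mul_integral h3
    mφ.aestronglyMeasurable mψ.aestronglyMeasurable
  refine h4.trans ?_
  have h5 : ∫ u : Fin p → ℝ, (compInd ν t' (u j) - compInd ν t (u j)) ∂(Measure.pi fun _ => ν) =
      0 := by
    have := integral_comp_eval (μ := fun _ : Fin p => ν) (i := j)
      (f := fun r => compInd ν t' r - compInd ν t r)
      ((measurable_compInd ν t').sub (measurable_compInd ν t)).aestronglyMeasurable
    refine this.trans ?_
    rw [integral_sub (integrable_compInd ν t') (integrable_compInd ν t), integral_compInd ν ht,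
      integral_compInd ν ht', sub_zero]
  exact mul_eq_zero_of_right _ h5

lemma exp_mul_measureReal_le_integral_exists_compInd (ν : Measure ℝ) [IsProbabilityMeasure ν]
    {t : ℕ → ℝ} (htm : Monotone t) (K : ℕ) (hK : ν.real (Set.Iic (t K)) < 1) {s : ℝ} (hs : 0 ≤ s)
    (x : ℝ) :
    Real.exp (s * x) * (Measure.pi fun _ : Fin p => ν).real
      {u | ∃ k ≤ K, x ≤ ∑ j, compInd ν (t k) (u j)} ≤
    ∫ u, Real.exp (s * ∑ j, compInd ν (t K) (u j)) ∂(Measure.pi fun _ : Fin p => ν) := by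
  set P := Measure.pi fun _ : Fin p => ν with hP
  set Y : ℕ → (Fin p → ℝ) → ℝ := fun k u => ∑ j, compInd ν (t k) (u j) with hY
  have mY : ∀ k, Measurable (Y k) := fun k =>
    Finset.measurable_sum _ fun j _ => (measurable_compInd ν _).comp (measurable_pi_apply j)
  have bY : ∀ k, ∃ C, ∀ u, |Y k u| ≤ C := fun k =>
    ⟨_, fun u => (Finset.abs_sum_le_sum_abs _ _).trans
      (Finset.sum_le_sum fun j _ => abs_compInd_le ν (t k) (u j))⟩
  have mE : ∀ k, Measurable fun u => Real.exp (s * Y k u) := fun k =>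
    Real.measurable_exp.comp ((mY k).const_mul s)
  have bE : ∀ k, ∃ C, ∀ u, |Real.exp (s * Y k u)| ≤ C := fun k => by
    obtain ⟨C, hC⟩ := bY k
    refine ⟨Real.exp (s * C), fun u => ?_⟩
    rw [abs_of_pos (Real.exp_pos _)]
    exact Real.exp_le_exp.2 (mul_le_mul_of_nonneg_left ((le_abs_self _).trans (hC u)) hs)
  have iE : ∀ k, Integrable (fun u => Real.exp (s * Y k u)) P := fun k => by
    obtain ⟨C, hC⟩ := bE k
    exact Integrable.of_bound (mE k).aestronglyMeasurable C (ae_of_all _ hC)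
  set A : ℕ → Set (Fin p → ℝ) := fun k => {u | x ≤ Y k u ∧ ∀ i < k, Y i u < x} with hA
  have mA : ∀ k, MeasurableSet (A k) := fun k => by
    have : A k = {u | x ≤ Y k u} ∩ ⋂ i : ℕ, ⋂ _ : i < k, {u | Y i u < x} := by
      ext u; simp [hA]
    rw [this]
    exact (measurableSet_le measurable_const (mY k)).inter (MeasurableSet.iInter fun i =>
      MeasurableSet.iInter fun _ => measurableSet_lt (mY i) measurable_const)
  have hstep : ∀ k ≤ K, Real.exp (s * x) * P.real (A k) ≤
      ∫ u, (A k).indicator (fun u => Real.exp (s * Y K u)) u ∂P := by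
    intro k hk
    set g : (Fin p → ℝ) → ℝ := (A k).indicator fun u => Real.exp (s * Y k u) with hg
    have mg : Measurable g := (mE k).indicator (mA k)
    have ig : Integrable g P := (iE k).indicator (mA k)
    have h1 : Real.exp (s * x) * P.real (A k) ≤ ∫ u, g u ∂P := by
      have : Real.exp (s * x) * P.real (A k) =
          ∫ u, (A k).indicator (fun _ => Real.exp (s * x)) u ∂P := by
        rw [integral_indicator_const _ (mA k), smul_eq_mul, mul_comm]
      rw [this]
      refine integral_mono ((integrable_const _).indicator (mA k)) ig fun u => ?_
      by_cases hu : u ∈ A k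
      · simp only [hg, Set.indicator_of_mem hu]
        exact Real.exp_le_exp.2 (mul_le_mul_of_nonneg_left hu.1 hs)
      · simp [hg, Set.indicator_of_notMem hu]
    have ij : ∀ j : Fin p, Integrable
        (fun u => g u * (compInd ν (t K) (u j) - compInd ν (t k) (u j))) P := fun j => by
      refine ig.mul_bdd (c := (1 + |ν.real (Set.Iic (t K)) / (1 - ν.real (Set.Iic (t K)))|) +
          (1 + |ν.real (Set.Iic (t k)) / (1 - ν.real (Set.Iic (t k)))|))
        ?_ (ae_of_all _ fun u => ?_)
      · exact (((measurable_compInd ν _).comp (measurable_pi_apply j)).sub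
          ((measurable_compInd ν _).comp (measurable_pi_apply j))).aestronglyMeasurable
      · exact (abs_sub _ _).trans (add_le_add (abs_compInd_le _ _ _) (abs_compInd_le _ _ _))
    have h2 : ∫ u, ∑ j, g u * (compInd ν (t K) (u j) - compInd ν (t k) (u j)) ∂P = 0 := by
      rw [integral_finsetSum _ fun j _ => ij j]
      refine Finset.sum_eq_zero fun j _ => ?_
      refine integral_mul_compInd_sub ν (c := t K + 1) (htm hk) hK j g mg fun u hu => ?_
      have hYi : ∀ i ≤ k, Y i (Function.update u j (t K + 1)) = Y i u := fun i hi => by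
        refine Finset.sum_congr rfl fun j' _ => ?_
        by_cases h : j' = j
        · subst h
          have h3 : ¬ u j' ≤ t i := not_le.2 ((htm hi).trans_lt hu)
          have h4 : ¬ t K + 1 ≤ t i := by linarith [htm (hi.trans hk)]
          simp [compInd, h3, h4]
        · simp [h]
      have hmem : Function.update u j (t K + 1) ∈ A k ↔ u ∈ A k := by
        simp only [hA, Set.mem_ofPred_eq, hYi k le_rfl]
        refine and_congr_right fun _ => forall₂_congr fun i hi => ?_
        rw [hYi i hi.le]
      by_cases hu' : u ∈ A k
      · simp only [hg, Set.indicator_of_mem hu', Set.indicator_of_mem (hmem.2 hu'), hYi k le_rfl]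
      · simp only [hg, Set.indicator_of_notMem hu', Set.indicator_of_notMem (mt hmem.1 hu')]
    have h3 : ∫ u, (g u + s * ∑ j, g u * (compInd ν (t K) (u j) - compInd ν (t k) (u j))) ∂P =
        ∫ u, g u ∂P := by
      rw [integral_add ig ((integrable_finsetSum _ fun j _ => ij j).const_mul s),
        integral_const_mul, h2, mul_zero, add_zero]
    rw [← h3] at h1
    refine h1.trans (integral_mono (ig.add ((integrable_finsetSum _ fun j _ => ij j).const_mul s))
      ((iE K).indicator (mA k)) fun u => ?_)
    simp only
    rw [← Finset.mul_sum, Finset.sum_sub_distrib]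
    change g u + s * (g u * (Y K u - Y k u)) ≤ _
    by_cases hu : u ∈ A k
    · simp only [hg, Set.indicator_of_mem hu]
      have e : Real.exp (s * Y K u) = Real.exp (s * Y k u) * Real.exp (s * (Y K u - Y k u)) := by
        rw [← Real.exp_add]; ring_nf
      rw [e]
      nlinarith [Real.add_one_le_exp (s * (Y K u - Y k u)), Real.exp_pos (s * Y k u)]
    · simp [hg, Set.indicator_of_notMem hu]
  have hcov : {u | ∃ k ≤ K, x ≤ Y k u} ⊆ ⋃ k ∈ Finset.range (K + 1), A k := by
    rintro u ⟨k, hk, hx⟩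
    have hex : ∃ k, x ≤ Y k u := ⟨k, hx⟩
    simp only [Set.mem_iUnion, Finset.mem_range]
    exact ⟨Nat.find hex, by have := Nat.find_min' hex hx; omega, Nat.find_spec hex,
      fun i hi => not_le.1 (Nat.find_min hex hi)⟩
  have hsum : ∀ u, ∑ k ∈ Finset.range (K + 1),
      (A k).indicator (fun u => Real.exp (s * Y K u)) u ≤ Real.exp (s * Y K u) := by
    intro u
    by_cases h : ∃ k ∈ Finset.range (K + 1), u ∈ A k
    · obtain ⟨k, hk, hu⟩ := h
      rw [Finset.sum_eq_single_of_mem k hk, Set.indicator_of_mem hu]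
      intro i _ hik
      refine Set.indicator_of_notMem (fun hi => ?_) _
      rcases lt_or_gt_of_ne hik with h | h
      · exact absurd hi.1 (not_le.2 (hu.2 i h))
      · exact absurd hu.1 (not_le.2 (hi.2 k h))
    · push Not at h
      rw [Finset.sum_eq_zero fun k hk => Set.indicator_of_notMem (h k hk) _]
      exact (Real.exp_pos _).le
  calc Real.exp (s * x) * P.real {u | ∃ k ≤ K, x ≤ Y k u}
      ≤ Real.exp (s * x) * ∑ k ∈ Finset.range (K + 1), P.real (A k) :=
        mul_le_mul_of_nonneg_left ((measureReal_mono hcov (measure_ne_top _ _)).trans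
          (measureReal_biUnion_finset_le _ _)) (Real.exp_pos _).le
    _ ≤ ∑ k ∈ Finset.range (K + 1), ∫ u, (A k).indicator (fun u => Real.exp (s * Y K u)) u ∂P := by
        rw [Finset.mul_sum]
        exact Finset.sum_le_sum fun k hk => hstep k (by simpa [Nat.lt_succ_iff] using hk)
    _ = ∫ u, ∑ k ∈ Finset.range (K + 1),
          (A k).indicator (fun u => Real.exp (s * Y K u)) u ∂P :=
        (integral_finsetSum _ fun k _ => (iE K).indicator (mA k)).symm
    _ ≤ ∫ u, Real.exp (s * Y K u) ∂P :=
        integral_mono (integrable_finsetSum _ fun k _ => (iE K).indicator (mA k)) (iE K) hsum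

/-- Exponential maximal inequality for the compensated empirical process on a finite grid. -/
lemma measureReal_exists_compInd_le (ν : Measure ℝ) [IsProbabilityMeasure ν]
    {t : ℕ → ℝ} (htm : Monotone t) (K : ℕ) (hK : ν.real (Set.Iic (t K)) < 1) {s : ℝ} (hs : 0 ≤ s)
    (hs1 : s ≤ 1) (x : ℝ) :
    (Measure.pi fun _ : Fin p => ν).real {u | ∃ k ≤ K, x ≤ ∑ j, compInd ν (t k) (u j)} ≤
      Real.exp (-(s * x) +
        s ^ 2 * (p * (ν.real (Set.Iic (t K)) / (1 - ν.real (Set.Iic (t K)))))) := by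
  have h := exp_mul_measureReal_le_integral_exists_compInd (p := p) ν htm K hK hs x
  have e : ∫ u, Real.exp (s * ∑ j, compInd ν (t K) (u j)) ∂(Measure.pi fun _ : Fin p => ν) =
      (∫ r, Real.exp (s * compInd ν (t K) r) ∂ν) ^ p := by
    simp_rw [Finset.mul_sum, Real.exp_sum]
    have := integral_fintype_prod_eq_pow (𝕜 := ℝ) (ι := Fin p)
      (fun r => Real.exp (s * compInd ν (t K) r)) (μ := ν)
    simpa using this
  rw [e] at h
  have h2 := h.trans (pow_le_pow_left₀ (integral_nonneg fun _ => (Real.exp_pos _).le)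
    (integral_exp_compInd_le ν hK hs hs1) p)
  rw [← Real.exp_nat_mul] at h2
  rw [Real.exp_add, Real.exp_neg, ← div_eq_inv_mul, le_div_iff₀ (Real.exp_pos _), mul_comm]
  refine h2.trans (le_of_eq ?_)
  congr 1
  ring

/-- The number of coordinates of `u` that are at most `t`. -/
noncomputable def countLe (u : Fin p → ℝ) (t : ℝ) : ℝ := ∑ j, if u j ≤ t then 1 else 0

lemma countLe_mono (u : Fin p → ℝ) {t t' : ℝ} (h : t ≤ t') : countLe u t ≤ countLe u t' := by
  refine Finset.sum_le_sum fun j _ => ?_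
  by_cases h1 : u j ≤ t
  · simp [h1, h1.trans h]
  · rw [if_neg h1]; split_ifs <;> norm_num

lemma countLe_le (u : Fin p → ℝ) (t : ℝ) : countLe u t ≤ p := by
  refine (Finset.sum_le_sum (g := fun _ => (1 : ℝ)) fun j _ => ?_).trans (by simp)
  split_ifs <;> norm_num

lemma sum_compInd (ν : Measure ℝ) {t : ℝ} (ht : ν.real (Set.Iic t) < 1) (u : Fin p → ℝ) :
    ∑ j, compInd ν t (u j) = p - (p - countLe u t) / (1 - ν.real (Set.Iic t)) := by
  have h : 1 - ν.real (Set.Iic t) ≠ 0 := by linarith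
  have e : ∀ j, compInd ν t (u j) =
      1 - (1 - (if u j ≤ t then 1 else 0)) / (1 - ν.real (Set.Iic t)) := fun j => by
    unfold compInd
    split_ifs
    · simp
    · field_simp; ring
  simp_rw [e]
  rw [Finset.sum_sub_distrib, ← Finset.sum_div, Finset.sum_sub_distrib]
  simp [countLe]

/-- Continuous-time version of the maximal inequality, for superuniform coordinates. -/
lemma measureReal_exists_mem_Icc_countLe_le (ν : Measure ℝ) [IsProbabilityMeasure ν]
    (hν : ∀ t, 0 ≤ t → ν.real (Set.Iic t) ≤ t) {a c s x : ℝ} (ha : 0 ≤ a) (hac : a < c)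
    (hc : c < 1) (hs : 0 ≤ s) (hs1 : s ≤ 1) (hx : 0 ≤ x) :
    (Measure.pi fun _ : Fin p => ν).real
      {u | ∃ t ∈ Set.Icc a c, p * t + x * (1 - t) ≤ countLe u t} ≤
      Real.exp (-(s * x) + s ^ 2 * (p * (c / (1 - c)))) := by
  set D := (p : ℝ) * (c - a) / (1 - c) with hD
  have h1c : 0 < 1 - c := by linarith
  have hca : 0 < c - a := by linarith
  have key : ∀ K : ℕ, (Measure.pi fun _ : Fin p => ν).real
      {u | ∃ t ∈ Set.Icc a c, p * t + x * (1 - t) ≤ countLe u t} ≤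
      Real.exp (-(s * (x - D / ((K + 1 : ℕ) : ℝ))) + s ^ 2 * (p * (c / (1 - c)))) := by
    intro K
    set M : ℝ := ((K + 1 : ℕ) : ℝ) with hM
    have hM0 : 0 < M := by rw [hM]; positivity
    set τ : ℕ → ℝ := fun i => a + (c - a) * i / M with hτ
    have τm : Monotone τ := fun i j hij => by
      simp only [hτ]
      have : (i : ℝ) ≤ j := by exact_mod_cast hij
      gcongr
    have τK : τ (K + 1) = c := by
      simp only [hτ, ← hM]; field_simp; ring
    have hF : ν.real (Set.Iic (τ (K + 1))) < 1 := by
      rw [τK]; exact (hν c (by linarith)).trans_lt hc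
    refine le_trans (measureReal_mono (s₂ := {u | ∃ k ≤ K + 1,
      x - D / M ≤ ∑ j, compInd ν (τ k) (u j)}) ?_ (measure_ne_top _ _))
      ((measureReal_exists_compInd_le ν τm (K + 1) hF hs hs1 _).trans
        (Real.exp_le_exp.2 (add_le_add le_rfl ?_)))
    · rintro u ⟨t, ⟨hat, htc⟩, ht⟩
      set k := ⌈(t - a) * M / (c - a)⌉₊ with hk
      have hkK : k ≤ K + 1 := by
        refine Nat.ceil_le.2 ?_
        rw [div_le_iff₀ hca, ← hM, mul_comm]
        exact mul_le_mul_of_nonneg_left (by linarith) hM0.le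
      have hk1 : t ≤ τ k := by
        have := Nat.le_ceil ((t - a) * M / (c - a))
        rw [div_le_iff₀ hca, ← hk] at this
        have h2 : t - a ≤ (c - a) * k / M := by
          rw [le_div_iff₀ hM0]; linarith
        simp only [hτ]; linarith
      have hk2 : τ k ≤ t + (c - a) / M := by
        have := (Nat.ceil_lt_add_one (a := (t - a) * M / (c - a))
          (div_nonneg (mul_nonneg (by linarith) hM0.le) hca.le)).le
        rw [← hk, ← sub_le_iff_le_add, le_div_iff₀ hca] at this
        simp only [hτ]
        rw [← sub_nonneg]
        have e : t + (c - a) / M - (a + (c - a) * k / M) =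
            ((t - a) * M - (k - 1) * (c - a)) / M := by field_simp; ring
        rw [e]
        exact div_nonneg (by linarith) hM0.le
      have hkc : τ k ≤ c := τK ▸ τm hkK
      refine ⟨k, hkK, ?_⟩
      have hFk : ν.real (Set.Iic (τ k)) ≤ τ k := hν _ (by linarith)
      rw [sum_compInd ν (by linarith)]
      have h3 : ((p : ℝ) - countLe u (τ k)) / (1 - ν.real (Set.Iic (τ k))) ≤
          (p - countLe u t) / (1 - τ k) :=
        div_le_div₀ (by linarith [countLe_le u t]) (by linarith [countLe_mono u hk1])
          (by linarith) (by linarith)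
      have h4 : (p - countLe u t) / (1 - τ k) ≤ (p - x) * (1 - t) / (1 - τ k) :=
        div_le_div_of_nonneg_right (by linarith) (by linarith)
      have h5 : (p - x) * (1 - t) / (1 - τ k) = p - x + (p - x) * ((τ k - t) / (1 - τ k)) := by
        have : 1 - τ k ≠ 0 := by linarith
        field_simp; ring
      have h6 : (τ k - t) / (1 - τ k) ≤ (c - a) / M / (1 - c) :=
        div_le_div₀ (by positivity) (by linarith) h1c (by linarith)
      have h7 : 0 ≤ (τ k - t) / (1 - τ k) := div_nonneg (by linarith) (by linarith)
      have h8 : (p - x) * ((τ k - t) / (1 - τ k)) ≤ p * ((c - a) / M / (1 - c)) :=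
        (mul_le_mul_of_nonneg_right (by linarith) h7).trans
          (mul_le_mul_of_nonneg_left h6 (by positivity))
      have h9 : p * ((c - a) / M / (1 - c)) = D / M := by rw [hD]; ring
      linarith
    · have h0 := hν c (by linarith)
      have hc0 : 0 ≤ c := by linarith
      rw [τK]
      gcongr
  refine ge_of_tendsto (x := atTop) ?_ (Eventually.of_forall key)
  have h1 : Tendsto (fun K : ℕ => D / ((K + 1 : ℕ) : ℝ)) atTop (nhds 0) :=
    (tendsto_const_div_atTop_nhds_zero_nat D).comp (tendsto_add_atTop_nat 1)
  have h2 : Tendsto (fun K : ℕ => -(s * (x - D / ((K + 1 : ℕ) : ℝ))) + s ^ 2 * (p * (c / (1 - c))))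
      atTop (nhds (-(s * (x - 0)) + s ^ 2 * (p * (c / (1 - c))))) :=
    (((h1.const_sub x).const_mul s).neg).add_const _
  rw [sub_zero] at h2
  exact (Real.continuous_exp.tendsto _).comp h2

lemma measureReal_exists_mem_block_countLe_le (ν : Measure ℝ) [IsProbabilityMeasure ν]
    (hν : ∀ t, 0 ≤ t → ν.real (Set.Iic t) ≤ t) (hp : 0 < p) {a lam : ℝ} (ha : 0 < a)
    (ha2 : a ≤ 1 / 2) (hl : 0 < lam) :
    (Measure.pi fun _ : Fin p => ν).real
      {u | ∃ t ∈ Set.Icc a (121 / 100 * a),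
        p * t + lam * √(p * (t * (1 - t))) ≤ countLe u t} ≤
      Real.exp (-(3 / 20 * lam ^ 2)) + Real.exp (-(lam * √(p * a) / 2)) := by
  have hp' : (0 : ℝ) < p := by exact_mod_cast hp
  set c := 121 / 100 * a with hc
  set x := lam * √(p * (a / (1 - a))) with hx
  set v := p * (c / (1 - c)) with hv
  have h1a : 0 < 1 - a := by linarith
  have h1c : 0 < 1 - c := by linarith
  have hc0 : 0 < c := by positivity
  have hv0 : 0 < v := by positivity
  have hx0 : 0 < x := by positivity
  have hsub : {u : Fin p → ℝ | ∃ t ∈ Set.Icc a c,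
      p * t + lam * √(p * (t * (1 - t))) ≤ countLe u t} ⊆
      {u | ∃ t ∈ Set.Icc a c, p * t + x * (1 - t) ≤ countLe u t} := by
    rintro u ⟨t, ht, h⟩
    refine ⟨t, ht, le_trans (add_le_add le_rfl ?_) h⟩
    have h1t : 0 < 1 - t := by linarith [ht.2]
    rw [hx, mul_assoc]
    refine mul_le_mul_of_nonneg_left ?_ hl.le
    refine Real.le_sqrt_of_sq_le ?_
    rw [mul_pow, Real.sq_sqrt (by positivity), mul_assoc]
    refine mul_le_mul_of_nonneg_left ?_ hp'.le
    rw [div_mul_eq_mul_div, div_le_iff₀ h1a]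
    have : a * (1 - t) ≤ t * (1 - a) := by linarith [ht.1]
    nlinarith
  have hmain : ∀ s, 0 ≤ s → s ≤ 1 → (Measure.pi fun _ : Fin p => ν).real
      {u | ∃ t ∈ Set.Icc a c, p * t + lam * √(p * (t * (1 - t))) ≤ countLe u t} ≤
      Real.exp (-(s * x) + s ^ 2 * v) := fun s hs hs1 =>
    (measureReal_mono hsub (measure_ne_top _ _)).trans
      (measureReal_exists_mem_Icc_countLe_le ν hν ha.le (by linarith) (by linarith) hs hs1 hx0.le)
  by_cases h : x ≤ 2 * v
  · refine (hmain (x / (2 * v)) (by positivity) ((div_le_one (by positivity)).2 h)).trans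
      (le_add_of_le_of_nonneg (Real.exp_le_exp.2 ?_) (Real.exp_pos _).le)
    have e : -(x / (2 * v) * x) + (x / (2 * v)) ^ 2 * v = -(x ^ 2 / v / 4) := by
      field_simp; ring
    rw [e]
    have h2 : 3 / 5 * lam ^ 2 ≤ x ^ 2 / v := by
      rw [hx, mul_pow, Real.sq_sqrt (by positivity), hv]
      have e2 : lam ^ 2 * (p * (a / (1 - a))) / (p * (c / (1 - c))) =
          lam ^ 2 * ((1 - c) / (121 / 100 * (1 - a))) := by
        rw [hc] at h1c ⊢
        field_simp
      rw [e2, mul_comm]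
      refine mul_le_mul_of_nonneg_left ?_ (by positivity)
      rw [le_div_iff₀ (by positivity)]
      linarith
    linarith
  · push Not at h
    refine (hmain 1 zero_le_one le_rfl).trans
      (le_add_of_nonneg_of_le (Real.exp_pos _).le (Real.exp_le_exp.2 ?_))
    have h2 : lam * √(p * a) ≤ x := by
      refine mul_le_mul_of_nonneg_left (Real.sqrt_le_sqrt (mul_le_mul_of_nonneg_left ?_ hp'.le))
        hl.le
      rw [le_div_iff₀ h1a]
      nlinarith
    linarith

lemma measureReal_exists_countLe_le (ν : Measure ℝ) [IsProbabilityMeasure ν]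
    (hν : ∀ t, 0 ≤ t → ν.real (Set.Iic t) ≤ t) (hp : 0 < p) {m lam : ℝ} (hm : 0 < m)
    (hl : 0 < lam) (K : ℕ) (hK : (p : ℝ) ≤ 2 * m * (121 / 100) ^ K) :
    (Measure.pi fun _ : Fin p => ν).real
      {u | ∃ t, 0 < t ∧ t < 1 / 2 ∧ 1 ≤ countLe u t ∧
        p * t + lam * √(p * (t * (1 - t))) ≤ countLe u t} ≤
      m + K * Real.exp (-(3 / 20 * lam ^ 2)) + 22 / (lam * √m) := by
  have hp' : (0 : ℝ) < p := by exact_mod_cast hp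
  set P := Measure.pi fun _ : Fin p => ν with hP
  set a : ℕ → ℝ := fun k => (121 / 100) ^ k * (m / p) with ha
  have ha0 : ∀ k, 0 < a k := fun k => by positivity
  set B : ℕ → Set (Fin p → ℝ) := fun k => {u | ∃ t ∈ Set.Icc (a k) (121 / 100 * a k), t < 1 / 2 ∧
        p * t + lam * √(p * (t * (1 - t))) ≤ countLe u t} with hB
  set S : Fin p → Set (Fin p → ℝ) := fun j => Function.eval j ⁻¹' Set.Iic (m / p) with hS
  have hcov : {u : Fin p → ℝ | ∃ t, 0 < t ∧ t < 1 / 2 ∧ 1 ≤ countLe u t ∧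
        p * t + lam * √(p * (t * (1 - t))) ≤ countLe u t} ⊆
      (⋃ j ∈ (Finset.univ : Finset (Fin p)), S j) ∪ ⋃ k ∈ Finset.range K, B k := by
    rintro u ⟨t, ht0, ht, h1, h2⟩
    by_cases hlt : t < m / p
    · left
      by_contra hcon
      simp only [Finset.mem_univ, Set.iUnion_true, Set.mem_iUnion, hS, Set.mem_preimage,
        Function.eval, Set.mem_Iic, not_exists, not_le] at hcon
      have : countLe u t = 0 :=
        Finset.sum_eq_zero fun j _ => if_neg (not_le.2 (hlt.trans (hcon j)))
      linarith
    · right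
      push Not at hlt
      have hmp : 0 < m / p := by positivity
      obtain ⟨k, hk1, hk2⟩ := exists_nat_pow_near (x := t / (m / p)) (y := (121 / 100 : ℝ))
        ((one_le_div hmp).2 hlt) (by norm_num)
      rw [le_div_iff₀ hmp] at hk1
      rw [div_lt_iff₀ hmp] at hk2
      simp only [Set.mem_iUnion, Finset.mem_range]
      refine ⟨k, ?_, t, ⟨hk1, by simp only [ha]; rw [← mul_assoc, ← pow_succ']; exact hk2.le⟩,
        ht, h2⟩
      by_contra hkK
      have h3 : (121 / 100 : ℝ) ^ K ≤ (121 / 100) ^ k :=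
        pow_le_pow_right₀ (by norm_num) (not_lt.1 hkK)
      have h4 : (121 / 100 : ℝ) ^ K * (m / p) ≤ t :=
        (mul_le_mul_of_nonneg_right h3 hmp.le).trans hk1
      have h5 : 1 / 2 ≤ (121 / 100 : ℝ) ^ K * (m / p) := by
        rw [mul_div_assoc', le_div_iff₀ hp']; linarith
      linarith
  have hSb : ∀ j, P.real (S j) ≤ m / p := fun j => by
    have := (measurePreserving_eval (fun _ : Fin p => ν) j).measureReal_preimage
      (measurableSet_Iic (a := m / p)).nullMeasurableSet
    rw [hS, hP, this]
    exact hν _ (by positivity)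
  have hBb : ∀ k, P.real (B k) ≤
      Real.exp (-(3 / 20 * lam ^ 2)) + 2 / (lam * √m) * (10 / 11) ^ k := fun k => by
    by_cases hak : a k ≤ 1 / 2
    · refine (measureReal_mono (s₂ := {u | ∃ t ∈ Set.Icc (a k) (121 / 100 * a k),
        p * t + lam * √(p * (t * (1 - t))) ≤ countLe u t}) ?_ (measure_ne_top _ _)).trans
        ((measureReal_exists_mem_block_countLe_le ν hν hp (ha0 k) hak hl).trans
          (add_le_add le_rfl ?_))
      · rintro u ⟨t, ht, _, h⟩
        exact ⟨t, ht, h⟩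
      · have e : √(p * a k) = (11 / 10) ^ k * √m := by
          have : (p : ℝ) * a k = ((11 / 10) ^ k) ^ 2 * m := by
            simp only [ha]
            rw [← pow_mul, mul_comm k 2, pow_mul]
            norm_num
            field_simp
          rw [this, Real.sqrt_mul (by positivity), Real.sqrt_sq (by positivity)]
        rw [e, Real.exp_neg]
        have hy : 0 < lam * ((11 / 10) ^ k * √m) / 2 := by positivity
        have h1 : lam * ((11 / 10) ^ k * √m) / 2 ≤ Real.exp (lam * ((11 / 10) ^ k * √m) / 2) := by
          linarith [Real.add_one_le_exp (lam * ((11 / 10) ^ k * √m) / 2)]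
        refine (inv_anti₀ hy h1).trans (le_of_eq ?_)
        have e2 : (10 / 11 : ℝ) ^ k = ((11 / 10) ^ k)⁻¹ := by
          rw [← inv_pow]; norm_num
        rw [e2]
        field_simp
    · have : B k = ∅ := by
        refine Set.eq_empty_of_forall_notMem ?_
        rintro u ⟨t, ht, h, _⟩
        exact hak (ht.1.trans h.le)
      rw [this, measureReal_empty]
      positivity
  have hgeom : ∑ k ∈ Finset.range K, (10 / 11 : ℝ) ^ k ≤ 11 := by
    rw [geom_sum_eq (by norm_num)]
    have : (0 : ℝ) ≤ (10 / 11) ^ K := by positivity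
    have e : ((10 / 11 : ℝ) ^ K - 1) / (10 / 11 - 1) = 11 * (1 - (10 / 11) ^ K) := by ring
    rw [e]; linarith
  calc _ ≤ P.real ((⋃ j ∈ (Finset.univ : Finset (Fin p)), S j) ∪ ⋃ k ∈ Finset.range K, B k) :=
        measureReal_mono hcov (measure_ne_top _ _)
    _ ≤ P.real (⋃ j ∈ (Finset.univ : Finset (Fin p)), S j) +
        P.real (⋃ k ∈ Finset.range K, B k) := measureReal_union_le _ _
    _ ≤ ∑ j, P.real (S j) + ∑ k ∈ Finset.range K, P.real (B k) :=
        add_le_add (measureReal_biUnion_finset_le _ _) (measureReal_biUnion_finset_le _ _)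
    _ ≤ ∑ j : Fin p, m / p + ∑ k ∈ Finset.range K,
        (Real.exp (-(3 / 20 * lam ^ 2)) + 2 / (lam * √m) * (10 / 11) ^ k) :=
        add_le_add (Finset.sum_le_sum fun j _ => hSb j) (Finset.sum_le_sum fun k _ => hBb k)
    _ = m + (K * Real.exp (-(3 / 20 * lam ^ 2)) +
        2 / (lam * √m) * ∑ k ∈ Finset.range K, (10 / 11 : ℝ) ^ k) := by
        rw [Finset.sum_add_distrib, Finset.mul_sum]
        simp
        field_simp
    _ ≤ m + (K * Real.exp (-(3 / 20 * lam ^ 2)) + 2 / (lam * √m) * 11) := by gcongr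
    _ = _ := by ring

instance isProbabilityMeasure_gaussPi (n : ℕ) : IsProbabilityMeasure (gaussPi n) := by
  unfold gaussPi; infer_instance

instance isProbabilityMeasure_noiseLaw (n p : ℕ) : IsProbabilityMeasure (noiseLaw n p) := by
  unfold noiseLaw; infer_instance

/-- Transposing an i.i.d. matrix. -/
lemma map_swap_pi_pi {α : Type*} [MeasurableSpace α] (μ : Measure α) [IsProbabilityMeasure μ]
    (n p : ℕ) :
    (Measure.pi fun _ : Fin n => Measure.pi fun _ : Fin p => μ).map (fun Z j i => Z i j) =
      Measure.pi fun _ : Fin p => Measure.pi fun _ : Fin n => μ := by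
  have hm : Measurable (fun (Z : Fin n → Fin p → α) (j : Fin p) (i : Fin n) => Z i j) := by
    fun_prop
  refine (Measure.pi_eq_generateFrom (fun _ => generateFrom_pi) (fun _ => isPiSystem_pi)
    (fun _ => Measure.FiniteSpanningSetsIn.pi fun _ => μ.toFiniteSpanningSetsIn) ?_).symm
  intro s hs
  choose t ht hts using hs
  rw [Measure.map_apply hm]
  · have : (fun (Z : Fin n → Fin p → α) (j : Fin p) (i : Fin n) => Z i j) ⁻¹' Set.pi Set.univ s =
        Set.pi Set.univ fun i => Set.pi Set.univ fun j => t j i := by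
      ext Z
      simp only [Set.mem_preimage, Set.mem_pi, Set.mem_univ, true_implies, ← hts]
      exact forall_comm
    rw [this, Measure.pi_pi]
    simp_rw [Measure.pi_pi, ← hts, Measure.pi_pi]
    exact Finset.prod_comm
  · refine MeasurableSet.univ_pi fun j => ?_
    rw [← hts j]
    exact MeasurableSet.univ_pi fun i => ht j i (Set.mem_univ i)

lemma map_swap_noiseLaw (n p : ℕ) :
    (noiseLaw n p).map (fun Z j i => Z i j) = Measure.pi fun _ : Fin p => gaussPi n :=
  map_swap_pi_pi _ n p

/-- Upper tail of the chi-square distribution with `n` degrees of freedom. -/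
noncomputable def chiTail (n : ℕ) (x : ℝ) : ℝ := (gaussPi n).real {z | x ≤ ∑ i, z i ^ 2}

lemma pvalue_eq_chiTail {n p : ℕ} (X : Fin n → Fin p → ℝ) (j : Fin p) :
    pvalue X j = chiTail n (∑ i, X i j ^ 2) := rfl

lemma chiTail_antitone (n : ℕ) : Antitone (chiTail n) := fun _ y h =>
  measureReal_mono (fun _ (hz : y ≤ _) => h.trans hz) (measure_ne_top _ _)

/-- Law of the chi-square P-value under the null. -/
noncomputable def pvalueLaw (n : ℕ) : Measure ℝ :=
  (gaussPi n).map fun z => chiTail n (∑ i, z i ^ 2)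

lemma measurable_chiTail_sum_sq (n : ℕ) :
    Measurable fun z : Fin n → ℝ => chiTail n (∑ i, z i ^ 2) :=
  (chiTail_antitone n).measurable.comp (by fun_prop)

instance isProbabilityMeasure_pvalueLaw (n : ℕ) : IsProbabilityMeasure (pvalueLaw n) :=
  Measure.isProbabilityMeasure_map (measurable_chiTail_sum_sq n).aemeasurable

lemma measurable_pvalue (n p : ℕ) :
    Measurable fun X : Fin n → Fin p → ℝ => pvalue X := by
  refine measurable_pi_lambda _ fun j => ?_
  exact (chiTail_antitone n).measurable.comp
    (f := fun X : Fin n → Fin p → ℝ => ∑ i, X i j ^ 2) (by fun_prop)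

lemma map_pvalue_noiseLaw (n p : ℕ) :
    (noiseLaw n p).map pvalue = Measure.pi fun _ : Fin p => pvalueLaw n := by
  have h : (pvalue : (Fin n → Fin p → ℝ) → Fin p → ℝ) =
      (fun x j => chiTail n (∑ i, x j i ^ 2)) ∘ (fun Z j i => Z i j) := rfl
  have hm := measurable_chiTail_sum_sq n
  have hm' : Measurable fun (x : Fin p → Fin n → ℝ) j => chiTail n (∑ i, x j i ^ 2) :=
    measurable_pi_lambda _ fun j => hm.comp (measurable_pi_apply j)
  rw [h, ← Measure.map_map hm' (by fun_prop), map_swap_noiseLaw]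
  have : ∀ i : Fin p, SigmaFinite ((gaussPi n).map fun z => chiTail n (∑ i, z i ^ 2)) :=
    fun _ => inferInstanceAs (SigmaFinite (pvalueLaw n))
  exact Measure.pi_map_pi fun _ => hm.aemeasurable

/-- The tail function of a probability measure, evaluated at a random sample from it, is
super-uniform. -/
lemma measureReal_tail_le {μ : Measure ℝ} [IsProbabilityMeasure μ] {t : ℝ} (ht : 0 ≤ t) :
    μ.real {x | μ.real (Set.Ici x) ≤ t} ≤ t := by
  have hG : Antitone fun x => μ.real (Set.Ici x) := fun x y h =>
    measureReal_mono (Set.Ici_subset_Ici.2 h) (measure_ne_top _ _)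
  have hS : MeasurableSet {x | μ.real (Set.Ici x) ≤ t} :=
    measurableSet_le hG.measurable measurable_const
  refine ENNReal.toReal_le_of_le_ofReal ht (le_of_forall_lt fun r hr => ?_)
  obtain ⟨K, hKS, hK, hrK⟩ := hS.exists_lt_isCompact_of_ne_top (measure_ne_top _ _) hr
  have hne : K.Nonempty := by
    rw [Set.nonempty_iff_ne_empty]
    rintro rfl
    simp at hrK
  have hx : μ.real (Set.Ici (sInf K)) ≤ t := hKS (hK.sInf_mem hne)
  have hle : μ K ≤ μ (Set.Ici (sInf K)) :=
    measure_mono fun y hy => csInf_le hK.bddBelow hy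
  refine hrK.trans_le (hle.trans ?_)
  rw [← ENNReal.ofReal_toReal (measure_ne_top μ (Set.Ici _))]
  exact ENNReal.ofReal_le_ofReal hx

lemma pvalueLaw_Iic_le (n : ℕ) (t : ℝ) (ht : 0 ≤ t) : (pvalueLaw n).real (Set.Iic t) ≤ t := by
  have hm : Measurable fun z : Fin n → ℝ => ∑ i, z i ^ 2 := by fun_prop
  have : IsProbabilityMeasure ((gaussPi n).map fun z => ∑ i, z i ^ 2) :=
    Measure.isProbabilityMeasure_map hm.aemeasurable
  have h1 : ∀ x, ((gaussPi n).map fun z => ∑ i, z i ^ 2).real (Set.Ici x) = chiTail n x := by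
    intro x
    rw [map_measureReal_apply hm measurableSet_Ici]
    rfl
  have h2 := measureReal_tail_le (μ := (gaussPi n).map fun z => ∑ i, z i ^ 2) ht
  simp_rw [h1] at h2
  have h3 : MeasurableSet {x | chiTail n x ≤ t} :=
    measurableSet_le (chiTail_antitone n).measurable measurable_const
  rw [map_measureReal_apply hm h3] at h2
  rw [pvalueLaw, map_measureReal_apply (measurable_chiTail_sum_sq n) measurableSet_Iic]
  exact h2

lemma finite_HC_values (f : Fin p → ℝ) :
    {h : ℝ | ∃ i : Fin p, 2 * (i.val + 1) ≤ p ∧ h = f i}.Finite :=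
  (Set.finite_range f).subset fun _ ⟨i, _, hi⟩ => ⟨i, hi.symm⟩

lemma succ_le_countLe_sort (u : Fin p → ℝ) (i : Fin p) :
    (i.val : ℝ) + 1 ≤ countLe u (u (Tuple.sort u i)) := by
  have hmono := Tuple.monotone_sort u
  have h1 : ((Finset.Iic i).map (Tuple.sort u).toEmbedding) ⊆
      Finset.univ.filter fun j => u j ≤ u (Tuple.sort u i) := by
    intro j hj
    obtain ⟨k, hk, rfl⟩ := Finset.mem_map.1 hj
    exact Finset.mem_filter.2 ⟨Finset.mem_univ _, hmono (Finset.mem_Iic.1 hk)⟩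
  have h2 := Finset.card_le_card h1
  rw [Finset.card_map, Fin.card_Iic] at h2
  rw [countLe, Finset.sum_boole]
  exact_mod_cast h2

lemma pvalue_nonneg {n : ℕ} (X : Fin n → Fin p → ℝ) (j : Fin p) : 0 ≤ pvalue X j :=
  ENNReal.toReal_nonneg

/-- If the Higher Criticism statistic is large, the empirical process of P-values is large
somewhere on `(0, 1/2)`. -/
lemma exists_countLe_of_le_HCstat {n : ℕ} (X : Fin n → Fin p → ℝ) {lam : ℝ} (hl : 0 < lam)
    (h : lam ≤ HCstat X) :
    ∃ t, 0 < t ∧ t < 1 / 2 ∧ 1 ≤ countLe (pvalue X) t ∧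
      p * t + lam * √(p * (t * (1 - t))) ≤ countLe (pvalue X) t := by
  unfold HCstat at h
  set S := {h : ℝ | ∃ i : Fin p, 2 * (i.val + 1) ≤ p ∧
    h = Real.sqrt p * (((i.val : ℝ) + 1) / p - pvalue X (Tuple.sort (pvalue X) i)) /
      Real.sqrt (pvalue X (Tuple.sort (pvalue X) i) *
        (1 - pvalue X (Tuple.sort (pvalue X) i)))} with hS
  have hfin : S.Finite := finite_HC_values _
  have hne : S.Nonempty := by
    rw [Set.nonempty_iff_ne_empty]
    intro h0
    rw [h0, Real.sSup_empty] at h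
    linarith
  obtain ⟨i, hi, hv⟩ := hne.csSup_mem hfin
  rw [hv] at h
  have hc := succ_le_countLe_sort (pvalue X) i
  set t := pvalue X (Tuple.sort (pvalue X) i) with ht
  have ht0 : 0 ≤ t := pvalue_nonneg X _
  have hp : (0 : ℝ) < p := by exact_mod_cast i.pos
  have hi' : ((i.val : ℝ) + 1) / p ≤ 1 / 2 := by
    rw [div_le_iff₀ hp]
    have : (2 : ℝ) * (i.val + 1) ≤ p := by exact_mod_cast hi
    linarith
  have hpos : 0 < t * (1 - t) := by
    by_contra hneg
    rw [Real.sqrt_eq_zero_of_nonpos (not_lt.1 hneg), div_zero] at h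
    linarith
  have hs : 0 < √(t * (1 - t)) := Real.sqrt_pos.2 hpos
  rw [le_div_iff₀ hs] at h
  have hsp : 0 < √(p : ℝ) := Real.sqrt_pos.2 hp
  have h1 : 0 < ((i.val : ℝ) + 1) / p - t := by
    have : 0 < √(p : ℝ) * (((i.val : ℝ) + 1) / p - t) := (mul_pos hl hs).trans_le h
    exact (mul_pos_iff_of_pos_left hsp).1 this
  refine ⟨t, ?_, by linarith, ?_, ?_⟩
  · rcases ht0.eq_or_lt with h0 | h0
    · rw [← h0] at hpos; simp at hpos
    · exact h0
  · have : (0 : ℝ) ≤ i.val := by positivity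
    linarith
  · have h2 : √(p : ℝ) * (√(p : ℝ) * (((i.val : ℝ) + 1) / p - t)) = i.val + 1 - p * t := by
      rw [← mul_assoc, Real.mul_self_sqrt hp.le]
      field_simp
    rw [Real.sqrt_mul hp.le]
    have h3 := mul_le_mul_of_nonneg_left h hsp.le
    linarith

lemma noiseLaw_HCstat_le {n : ℕ} (hp : 0 < p) {m lam : ℝ} (hm : 0 < m) (hl : 0 < lam) (K : ℕ)
    (hK : (p : ℝ) ≤ 2 * m * (121 / 100) ^ K) :
    (noiseLaw n p).real {X | lam ≤ HCstat X} ≤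
      m + K * Real.exp (-(3 / 20 * lam ^ 2)) + 22 / (lam * √m) := by
  refine le_trans ?_
    (measureReal_exists_countLe_le (pvalueLaw n) (pvalueLaw_Iic_le n) hp hm hl K hK)
  rw [← map_pvalue_noiseLaw]
  refine (measureReal_mono (s₂ := pvalue ⁻¹' _) (fun X (hX : lam ≤ HCstat X) => ?_)
    (measure_ne_top _ _)).trans
    (ENNReal.toReal_mono (measure_ne_top _ _)
      (Measure.le_map_apply (measurable_pvalue n p).aemeasurable _))
  exact exists_countLe_of_le_HCstat X hl hX

lemma tendsto_HC_null_bound : Tendsto (fun p : ℕ =>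
    1 / (2 * √(2 * Real.log (Real.log p))) + (100 * Real.log p + 1) *
      Real.exp (-(3 / 20 * (2 * √(2 * Real.log (Real.log p))) ^ 2)) +
      22 / ((2 * √(2 * Real.log (Real.log p))) *
        √(1 / (2 * √(2 * Real.log (Real.log p)))))) atTop (nhds 0) := by
  have hlog : Tendsto (fun p : ℕ => Real.log p) atTop atTop :=
    Real.tendsto_log_atTop.comp tendsto_natCast_atTop_atTop
  have hL : Tendsto (fun p : ℕ => 2 * √(2 * Real.log (Real.log p))) atTop atTop :=
    (Real.tendsto_sqrt_atTop.comp
      ((Real.tendsto_log_atTop.comp hlog).const_mul_atTop two_pos)).const_mul_atTop two_pos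
  have h1 : Tendsto (fun x : ℝ => 1 / x) atTop (nhds 0) := by
    simpa using tendsto_inv_atTop_zero (𝕜 := ℝ)
  have h2 : Tendsto (fun x : ℝ => (100 * x + 1) * x ^ (-(6 / 5 : ℝ))) atTop (nhds 0) := by
    have a1 := (tendsto_rpow_neg_atTop (y := 1 / 5) (by norm_num)).const_mul 100
    have a2 := (tendsto_rpow_neg_atTop (y := 6 / 5) (by norm_num))
    have a3 := a1.add a2
    rw [mul_zero, add_zero] at a3
    refine a3.congr' ?_
    filter_upwards [eventually_gt_atTop 0] with x hx
    have : x ^ (-(1 / 5) : ℝ) = x * x ^ (-(6 / 5) : ℝ) := by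
      rw [← Real.rpow_one_add' hx.le (by norm_num)]; norm_num
    rw [this]; ring
  have h3 : Tendsto (fun x : ℝ => 22 / (x * √(1 / x))) atTop (nhds 0) := by
    refine (tendsto_const_nhds (x := (22 : ℝ))).div_atTop ?_
    refine Real.tendsto_sqrt_atTop.congr' ?_
    filter_upwards [eventually_gt_atTop 0] with x hx
    rw [Real.sqrt_div zero_le_one, Real.sqrt_one, mul_one_div, Real.div_sqrt]
  have := ((h1.comp hL).add (h2.comp hlog)).add (h3.comp hL)
  simp only [add_zero] at this
  refine this.congr' ?_
  filter_upwards [hlog.eventually_gt_atTop 1] with p hp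
  simp only [Function.comp]
  congr 3
  rw [Real.rpow_def_of_pos (by linarith), mul_pow, Real.sq_sqrt]
  · congr 1; ring
  · have := Real.log_pos hp
    positivity

theorem tendsto_noiseLaw_rejHC (n : ℕ → ℕ) :
    Tendsto (fun p : ℕ => (noiseLaw (n p) p).real rejHC) atTop (nhds 0) := by
  have hlog : Tendsto (fun p : ℕ => Real.log p) atTop atTop :=
    Real.tendsto_log_atTop.comp tendsto_natCast_atTop_atTop
  refine tendsto_of_tendsto_of_tendsto_of_le_of_le' tendsto_const_nhds tendsto_HC_null_bound
    (Eventually.of_forall fun _ => measureReal_nonneg) ?_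
  filter_upwards [hlog.eventually_gt_atTop 1, eventually_gt_atTop 1] with p hp hp1
  have hpp : (0 : ℝ) < p := by positivity
  set lam := 2 * √(2 * Real.log (Real.log p)) with hlam
  have hLL := Real.log_pos hp
  have hl : 0 < lam := by positivity
  refine (noiseLaw_HCstat_le (by omega) (m := 1 / lam) (by positivity) hl
    ⌈100 * Real.log p⌉₊ ?_).trans ?_
  · have hll : Real.log (Real.log p) ≤ p := by
      have a1 := Real.log_le_sub_one_of_pos (x := Real.log p) (by linarith)
      have a2 := Real.log_le_sub_one_of_pos hpp
      linarith
    have hlp : lam ≤ 2 * p ^ 2 := by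
      have b1 : √(2 * Real.log (Real.log p)) ≤ p ^ 2 := by
        rw [Real.sqrt_le_left (by positivity)]
        have : (2 : ℝ) ≤ p := by exact_mod_cast hp1
        have c1 : (p : ℝ) * 2 ≤ p ^ 2 := by nlinarith
        nlinarith
      linarith
    have hk : (p : ℝ) ^ 10 ≤ (121 / 100) ^ ⌈100 * Real.log p⌉₊ := by
      rw [← Real.log_le_log_iff (by positivity) (by positivity), Real.log_pow, Real.log_pow]
      have d1 := Nat.le_ceil (100 * Real.log p)
      have d2 : (1 / 10 : ℝ) ≤ Real.log (121 / 100) := by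
        have := Real.one_sub_inv_le_log_of_pos (x := 121 / 100) (by norm_num)
        norm_num at this ⊢
        linarith
      have d3 := mul_le_mul d1 d2 (by norm_num) (by positivity)
      push_cast
      linarith
    have hp3 : (p : ℝ) ^ 3 ≤ p ^ 10 :=
      pow_le_pow_right₀ (by exact_mod_cast hp1.le) (by norm_num)
    rw [mul_one_div, div_mul_eq_mul_div, le_div_iff₀ hl]
    have e1 : (p : ℝ) * lam ≤ p * (2 * p ^ 2) := mul_le_mul_of_nonneg_left hlp hpp.le
    linarith
  · have := (Nat.ceil_lt_add_one (a := 100 * Real.log p) (by linarith)).le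
    gcongr

/-- Chebyshev's inequality for sums of independent coordinates. -/
lemma measureReal_pi_le_abs_sum_sub {n : ℕ} (ν : Measure ℝ) [IsProbabilityMeasure ν]
    {f : Fin n → ℝ → ℝ} (hf : ∀ i, MemLp (f i) 2 ν) {c V u : ℝ} (hc : ∀ i, ∫ x, f i x ∂ν = c)
    (hV : ∀ i, Var[f i; ν] ≤ V) (hu : 0 < u) :
    (Measure.pi fun _ : Fin n => ν).real {w | u ≤ |∑ i, f i (w i) - n * c|} ≤ n * V / u ^ 2 := by
  have hmem : ∀ i, MemLp (fun w : Fin n → ℝ => f i (w i)) 2 (Measure.pi fun _ : Fin n => ν) :=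
    fun i => (hf i).comp_measurePreserving (measurePreserving_eval (fun _ : Fin n => ν) i)
  have hfun : (∑ i, fun w : Fin n → ℝ => f i (w i)) = fun w => ∑ i, f i (w i) := by
    ext w; simp
  have hS : MemLp (fun w : Fin n → ℝ => ∑ i, f i (w i)) 2 (Measure.pi fun _ : Fin n => ν) :=
    memLp_finsetSum _ fun i _ => hmem i
  have hE : ∫ w, ∑ i, f i (w i) ∂(Measure.pi fun _ : Fin n => ν) = n * c := by
    rw [integral_finsetSum _ fun i _ => (hmem i).integrable one_le_two]
    rw [Finset.sum_congr rfl fun i _ => (integral_comp_eval (μ := fun _ : Fin n => ν) (i := i)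
      (hf i).aestronglyMeasurable).trans (hc i)]
    simp
  have hvar := variance_sum_pi (μ := fun _ : Fin n => ν) hf
  rw [hfun] at hvar
  have h := meas_ge_le_variance_div_sq hS hu
  rw [hE, hvar] at h
  have hle : ∑ i, Var[f i; ν] ≤ n * V := by
    simpa using Finset.sum_le_sum fun i (_ : i ∈ Finset.univ) => hV i
  have hVn : 0 ≤ ∑ i, Var[f i; ν] := Finset.sum_nonneg fun i _ => variance_nonneg _ _
  refine ENNReal.toReal_le_of_le_ofReal (div_nonneg (hVn.trans hle) (sq_nonneg _)) (h.trans ?_)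
  exact ENNReal.ofReal_le_ofReal (by gcongr)

/-- Variance of the square of a standard Gaussian. -/
noncomputable def sqVar : ℝ := ∫ z, (z ^ 2 - 1) ^ 2 ∂gaussianReal 0 1

lemma sqVar_nonneg : 0 ≤ sqVar := integral_nonneg fun _ => sq_nonneg _

lemma integral_sq_gaussianReal : ∫ z, z ^ 2 ∂gaussianReal 0 1 = 1 := by
  have h := variance_id_gaussianReal (μ := 0) (v := 1)
  rw [variance_eq_integral aemeasurable_id] at h
  simpa using h

lemma integrable_pow_gaussianReal (k : ℕ) : Integrable (fun z : ℝ => z ^ k) (gaussianReal 0 1) := by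
  have h := memLp_id_gaussianReal (μ := 0) (v := 1) k
  rcases Nat.eq_zero_or_pos k with rfl | hk
  · simp
  refine (integrable_norm_iff (by fun_prop)).1 ?_
  have := h.integrable_norm_pow (by omega)
  simpa using this

lemma memLp_shift_sq (a : ℝ) : MemLp (fun z : ℝ => (a + z) ^ 2) 2 (gaussianReal 0 1) := by
  refine (memLp_two_iff_integrable_sq (by fun_prop)).2 ?_
  have h : (fun z : ℝ => ((a + z) ^ 2) ^ 2) = fun z => a ^ 4 + 4 * a ^ 3 * z ^ 1
      + 6 * a ^ 2 * z ^ 2 + 4 * a * z ^ 3 + z ^ 4 := by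
    ext z; ring
  rw [h]
  have i := integrable_pow_gaussianReal
  exact (((((integrable_const _).add ((i 1).const_mul _)).add ((i 2).const_mul _)).add
    ((i 3).const_mul _)).add (i 4))

lemma integral_shift_sq (a : ℝ) : ∫ z, (a + z) ^ 2 ∂gaussianReal 0 1 = 1 + a ^ 2 := by
  have i := integrable_pow_gaussianReal
  have h : (fun z : ℝ => (a + z) ^ 2) = fun z => a ^ 2 + 2 * a * z ^ 1 + z ^ 2 := by
    ext z; ring
  have i1 : Integrable (fun z : ℝ => a ^ 2 + 2 * a * z ^ 1) (gaussianReal 0 1) :=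
    (integrable_const _).add ((i 1).const_mul _)
  rw [h, integral_add i1 (i 2), integral_add (integrable_const _) ((i 1).const_mul _),
    integral_const_mul, integral_sq_gaussianReal]
  simp
  ring

lemma variance_shift_sq_le (a : ℝ) :
    Var[fun z => (a + z) ^ 2; gaussianReal 0 1] ≤ 8 * a ^ 2 + 2 * sqVar := by
  have i := integrable_pow_gaussianReal
  have i4 : Integrable (fun z : ℝ => (z ^ 2 - 1) ^ 2) (gaussianReal 0 1) := by
    have h : (fun z : ℝ => (z ^ 2 - 1) ^ 2) = fun z => z ^ 4 - 2 * z ^ 2 + 1 := by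
      ext z; ring
    rw [h]
    exact ((i 4).sub ((i 2).const_mul _)).add (integrable_const _)
  rw [variance_eq_integral (by fun_prop), integral_shift_sq]
  have h : ∫ z, (8 * a ^ 2 * z ^ 2 + 2 * (z ^ 2 - 1) ^ 2) ∂gaussianReal 0 1 =
      8 * a ^ 2 + 2 * sqVar := by
    rw [integral_add ((i 2).const_mul _) (i4.const_mul _), integral_const_mul, integral_const_mul,
      integral_sq_gaussianReal, sqVar, mul_one]
  rw [← h]
  refine integral_mono_of_nonneg (Eventually.of_forall fun z => sq_nonneg _)
    (((i 2).const_mul _).add (i4.const_mul _)) (Eventually.of_forall fun z => ?_)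
  simp only
  nlinarith [sq_nonneg (2 * a * z - (z ^ 2 - 1))]

/-- Concentration of a noncentral chi-square variable with equal squared shifts. -/
lemma gaussPi_le_abs_sum_shift_sq_sub {n : ℕ} {s : Fin n → ℝ} {a u : ℝ} (hs : ∀ i, s i ^ 2 = a)
    (hu : 0 < u) :
    (gaussPi n).real {w | u ≤ |∑ i, (s i + w i) ^ 2 - n * (1 + a)|} ≤
      n * (8 * a + 2 * sqVar) / u ^ 2 :=
  measureReal_pi_le_abs_sum_sub (gaussianReal 0 1) (fun i => memLp_shift_sq (s i))
    (fun i => by rw [integral_shift_sq, hs]) (fun i => by rw [← hs i]; exact variance_shift_sq_le _) hu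

/-- A noncentral chi-square variable exceeds half of its expected excess. -/
lemma gaussPi_sum_shift_sq_lt {n : ℕ} (hn : 0 < n) {s : Fin n → ℝ} {a : ℝ}
    (hs : ∀ i, s i ^ 2 = a) (ha : 0 < a) :
    (gaussPi n).real {w | ∑ i, (s i + w i) ^ 2 < n + n * a / 2} ≤
      (32 * a + 8 * sqVar) / (n * a ^ 2) := by
  have hn' : (0 : ℝ) < n := by exact_mod_cast hn
  have hu : 0 < n * a / 2 := by positivity
  have hsub : {w : Fin n → ℝ | ∑ i, (s i + w i) ^ 2 < n + n * a / 2} ⊆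
      {w | n * a / 2 ≤ |∑ i, (s i + w i) ^ 2 - n * (1 + a)|} := by
    intro w hw
    rw [Set.mem_ofPred_eq] at hw ⊢
    refine le_trans ?_ (neg_le_abs _)
    linarith
  have he : n * (8 * a + 2 * sqVar) / (n * a / 2) ^ 2 = (32 * a + 8 * sqVar) / (n * a ^ 2) := by
    field_simp
    ring
  rw [← he]
  exact (measureReal_mono hsub (measure_ne_top _ _)).trans
    (gaussPi_le_abs_sum_shift_sq_sub hs hu)

instance isProbabilityMeasure_signLaw : IsProbabilityMeasure signLaw := by
  refine ⟨?_⟩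
  simp only [signLaw, Measure.add_apply, Measure.smul_apply, measure_univ, smul_eq_mul, mul_one]
  exact ENNReal.add_halves 1

lemma isProbabilityMeasure_muLaw {ε : ℝ} (τ : ℝ) (h0 : 0 ≤ ε) (h1 : ε ≤ 1) :
    IsProbabilityMeasure (muLaw ε τ) := by
  refine ⟨?_⟩
  simp only [muLaw, Measure.add_apply, Measure.smul_apply, measure_univ, smul_eq_mul, mul_one]
  rw [← ENNReal.ofReal_add (by linarith) h0]
  simp

lemma ae_signLaw_sq : ∀ᵐ x ∂signLaw, x ^ 2 = 1 := by
  rw [ae_iff]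
  simp [signLaw]

lemma ae_pi_signLaw_sq (n : ℕ) : ∀ᵐ l ∂(Measure.pi fun _ : Fin n => signLaw), ∀ i, l i ^ 2 = 1 :=
  ae_all_iff.2 fun i =>
    (measurePreserving_eval (fun _ : Fin n => signLaw) i).quasiMeasurePreserving.ae ae_signLaw_sq

/-- Conditioning on labels and signal. -/
lemma jointLaw_real_le {n p : ℕ} {ε τ : ℝ} (h0 : 0 ≤ ε) (h1 : ε ≤ 1) {B : Set (Omega n p)}
    (hB : MeasurableSet B) {A : Set (Fin p → ℝ)} (hA : MeasurableSet A) {δ : ℝ} (hδ : 0 ≤ δ)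
    (h : ∀ l : Fin n → ℝ, (∀ i, l i ^ 2 = 1) → ∀ μ ∉ A,
      (noiseLaw n p).real {Z | (l, μ, Z) ∈ B} ≤ δ) :
    (jointLaw n p ε τ).real B ≤ (Measure.pi fun _ : Fin p => muLaw ε τ).real A + δ := by
  have := isProbabilityMeasure_muLaw τ h0 h1
  refine ENNReal.toReal_le_of_le_ofReal (by positivity) ?_
  rw [ENNReal.ofReal_add measureReal_nonneg hδ, ofReal_measureReal]
  set Q := (Measure.pi fun _ : Fin p => muLaw ε τ) A + ENNReal.ofReal δ with hQ
  have hin : ∀ l : Fin n → ℝ, (∀ i, l i ^ 2 = 1) →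
      ((Measure.pi fun _ : Fin p => muLaw ε τ).prod (noiseLaw n p)) (Prod.mk l ⁻¹' B) ≤ Q := by
    intro l hl
    rw [Measure.prod_apply (measurable_prodMk_left hB)]
    calc _ ≤ ∫⁻ μ, (A.indicator 1 μ + ENNReal.ofReal δ) ∂(Measure.pi fun _ : Fin p => muLaw ε τ) :=
          lintegral_mono fun μ => by
            by_cases hμ : μ ∈ A
            · rw [Set.indicator_of_mem hμ]
              exact prob_le_one.trans le_self_add
            · rw [Set.indicator_of_notMem hμ, zero_add]
              exact (ENNReal.le_ofReal_iff_toReal_le (measure_ne_top _ _) hδ).2 (h l hl μ hμ)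
      _ = Q := by
          rw [lintegral_add_right _ measurable_const, lintegral_indicator_one hA, lintegral_const,
            measure_univ, mul_one]
  rw [jointLaw, Measure.prod_apply hB]
  calc _ ≤ ∫⁻ _, Q ∂(Measure.pi fun _ : Fin n => signLaw) :=
        lintegral_mono_ae ((ae_pi_signLaw_sq n).mono hin)
    _ = Q := by rw [lintegral_const, measure_univ, mul_one]

lemma map_col_noiseLaw {n p : ℕ} (j : Fin p) :
    (noiseLaw n p).map (fun Z i => Z i j) = gaussPi n := by
  have h : (gaussPi p).map (Function.eval j) = gaussianReal 0 1 :=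
    (measurePreserving_eval (fun _ : Fin p => gaussianReal 0 1) j).map_eq
  have : ∀ _ : Fin n, SigmaFinite ((gaussPi p).map (Function.eval j)) := by
    rw [h]; intro _; infer_instance
  rw [gaussPi, ← h]
  exact Measure.pi_map_pi (f := fun _ : Fin n => Function.eval j)
    fun _ => (measurable_pi_apply j).aemeasurable

lemma map_normalized_sum_gaussPi (hp : 0 < p) :
    (gaussPi p).map (fun z => (√p)⁻¹ * ∑ j, z j) = gaussianReal 0 1 := by
  have hmp : ∀ j, MeasurePreserving (Function.eval j) (gaussPi p) (gaussianReal 0 1) :=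
    measurePreserving_eval (fun _ : Fin p => gaussianReal 0 1)
  have hi : iIndepFun (fun (j : Fin p) (z : Fin p → ℝ) => z j) (gaussPi p) :=
    iIndepFun_pi (μ := fun _ : Fin p => gaussianReal 0 1) (X := fun _ => id)
      fun _ => aemeasurable_id
  have hG : HasGaussianLaw (fun z : Fin p → ℝ => ∑ j, z j) (gaussPi p) :=
    iIndepFun.hasGaussianLaw_fun_sum (fun j => ⟨by
      rw [show (fun z : Fin p → ℝ => z j) = Function.eval j from rfl, (hmp j).map_eq]
      infer_instance⟩) hi
  have hmem : MemLp id 2 (gaussianReal 0 1) := memLp_id_gaussianReal 2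
  have hvar := variance_sum_pi (μ := fun _ : Fin p => gaussianReal 0 1) (X := fun _ => id)
    fun _ => hmem
  have hfun : (∑ j, fun z : Fin p → ℝ => id (z j)) = fun z => ∑ j, z j := by
    ext z; simp
  rw [hfun] at hvar
  have hV : Var[fun z => ∑ j, z j; gaussPi p] = p := by
    rw [gaussPi, hvar]
    simp [variance_id_gaussianReal]
  have hE : ∫ z, ∑ j, z j ∂gaussPi p = 0 := by
    have hint : ∀ j, Integrable (fun z : Fin p → ℝ => z j) (gaussPi p) := fun j =>
      (hmem.comp_measurePreserving (hmp j)).integrable one_le_two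
    rw [integral_finsetSum _ fun j _ => hint j]
    refine Finset.sum_eq_zero fun j _ => ?_
    have := integral_comp_eval (μ := fun _ : Fin p => gaussianReal 0 1) (i := j)
      (f := id) hmem.aestronglyMeasurable
    exact this.trans (by simp)
  have hlaw := hG.map_eq_gaussianReal
  rw [hE, hV] at hlaw
  have hp' : (0 : ℝ) < p := by exact_mod_cast hp
  rw [show (fun z : Fin p → ℝ => (√p)⁻¹ * ∑ j, z j) =
    (fun x : ℝ => (√p)⁻¹ * x) ∘ fun z : Fin p → ℝ => ∑ j, z j from rfl,
    ← Measure.map_map (by fun_prop) (by fun_prop), hlaw, gaussianReal_map_const_mul, mul_zero]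
  congr 1
  ext
  simp [Real.sq_sqrt hp'.le, hp'.ne']

lemma map_normalized_row_sum_noiseLaw (n : ℕ) (hp : 0 < p) :
    (noiseLaw n p).map (fun Z i => (√p)⁻¹ * ∑ j, Z i j) = gaussPi n := by
  have h := map_normalized_sum_gaussPi hp
  have : ∀ _ : Fin n, SigmaFinite ((gaussPi p).map (fun z => (√p)⁻¹ * ∑ j, z j)) := by
    rw [h]; intro _; infer_instance
  rw [gaussPi, ← h]
  exact Measure.pi_map_pi (f := fun (_ : Fin n) (z : Fin p → ℝ) => (√p)⁻¹ * ∑ j, z j)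
    fun _ => by fun_prop

lemma integral_exp_sq_gaussianReal {s : ℝ} :
    ∫ z, Real.exp (s * z ^ 2) ∂gaussianReal 0 1 = √(1 / (1 - 2 * s)) := by
  rw [integral_gaussianReal_eq_integral_smul one_ne_zero]
  have h : ∀ x : ℝ, gaussianPDFReal 0 1 x • Real.exp (s * x ^ 2) =
      (√(2 * Real.pi))⁻¹ * Real.exp (-((1 - 2 * s) / 2) * x ^ 2) := fun x => by
    rw [gaussianPDFReal, smul_eq_mul, mul_assoc, ← Real.exp_add]
    simp only [NNReal.coe_one, mul_one]
    congr 2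
    ring
  simp_rw [h]
  rw [integral_const_mul, integral_gaussian, ← Real.sqrt_inv, ← Real.sqrt_mul (by positivity)]
  congr 1
  have := Real.pi_pos.ne'
  by_cases hs : 1 - 2 * s = 0
  · simp [hs]
  · field_simp

lemma integral_exp_sq_gaussianReal_le {s : ℝ} (h0 : 0 ≤ s) (h1 : s ≤ 1 / 4) :
    ∫ z, Real.exp (s * z ^ 2) ∂gaussianReal 0 1 ≤ Real.exp (s + 2 * s ^ 2) := by
  rw [integral_exp_sq_gaussianReal, Real.sqrt_le_left (Real.exp_nonneg _), ← Real.exp_nat_mul,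
    div_le_iff₀ (by linarith)]
  set y : ℝ := ((2 : ℕ) : ℝ) * (s + 2 * s ^ 2) with hy
  have h2 : (0 : ℝ) ≤ y := by positivity
  refine le_trans ?_ (mul_le_mul_of_nonneg_right (Real.quadratic_le_exp_of_nonneg h2)
    (by linarith))
  rw [hy]
  push_cast
  have h3 : 0 ≤ s ^ 2 * (1 / 4 - s) := mul_nonneg (sq_nonneg _) (by linarith)
  have h4 : 0 ≤ s ^ 3 * (1 / 4 - s) := mul_nonneg (by positivity) (by linarith)
  nlinarith

/-- Chernoff bound for the upper tail of the chi-square distribution. -/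
lemma chiTail_le_exp {n : ℕ} (hn : 0 < n) {u : ℝ} (h0 : 0 ≤ u) (h1 : u ≤ n) :
    chiTail n (n + u) ≤ Real.exp (-(u ^ 2 / (8 * n))) := by
  have hn' : (0 : ℝ) < n := by exact_mod_cast hn
  set s := u / (4 * n) with hs
  have hs0 : 0 ≤ s := by positivity
  have hs1 : s ≤ 1 / 4 := by
    rw [hs, div_le_iff₀ (by positivity)]; linarith
  have hi1 : Integrable (fun z : ℝ => Real.exp (s * z ^ 2)) (gaussianReal 0 1) := by
    refine Integrable.of_integral_ne_zero ?_
    rw [integral_exp_sq_gaussianReal]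
    have : 0 < 1 / (1 - 2 * s) := by
      apply one_div_pos.2; linarith
    positivity
  have he : ∀ z : Fin n → ℝ, Real.exp (s * ∑ i, z i ^ 2) = ∏ i, Real.exp (s * z i ^ 2) := by
    intro z
    rw [Finset.mul_sum, Real.exp_sum]
  have hi : Integrable (fun z : Fin n → ℝ => Real.exp (s * ∑ i, z i ^ 2)) (gaussPi n) := by
    simp_rw [he]
    exact Integrable.fintype_prod (f := fun _ z => Real.exp (s * z ^ 2)) fun _ => hi1
  have hI : mgf (fun z : Fin n → ℝ => ∑ i, z i ^ 2) (gaussPi n) s ≤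
      Real.exp (s + 2 * s ^ 2) ^ n := by
    rw [mgf]
    simp_rw [he]
    rw [gaussPi, integral_fintype_prod_eq_prod (fun _ z => Real.exp (s * z ^ 2)),
      Finset.prod_const, Finset.card_univ, Fintype.card_fin]
    exact pow_le_pow_left₀ (integral_nonneg fun _ => (Real.exp_nonneg _))
      (integral_exp_sq_gaussianReal_le hs0 hs1) n
  refine (measure_ge_le_exp_mul_mgf (n + u) hs0 hi).trans ?_
  refine (mul_le_mul_of_nonneg_left hI (Real.exp_nonneg _)).trans (le_of_eq ?_)
  rw [← Real.exp_nat_mul, ← Real.exp_add]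
  congr 1
  rw [hs]
  field_simp
  ring

lemma chiTail_pos {n : ℕ} (hn : 0 < n) (x : ℝ) : 0 < chiTail n x := by
  have : (gaussianReal 0 1).IsOpenPosMeasure :=
    (gaussianReal_absolutelyContinuous' 0 one_ne_zero).isOpenPosMeasure
  have hpos : (gaussPi n).IsOpenPosMeasure := by unfold gaussPi; infer_instance
  have hopen : IsOpen {z : Fin n → ℝ | x < ∑ i, z i ^ 2} :=
    isOpen_lt continuous_const (by fun_prop)
  have hne : {z : Fin n → ℝ | x < ∑ i, z i ^ 2}.Nonempty := by
    refine ⟨fun _ => |x| + 1, ?_⟩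
    simp only [Set.mem_ofPred_eq, Finset.sum_const, Finset.card_univ, Fintype.card_fin,
      nsmul_eq_mul]
    have h1 : (1 : ℝ) ≤ n := by exact_mod_cast hn
    have h2 := le_abs_self x
    have h3 := abs_nonneg x
    nlinarith
  refine lt_of_lt_of_le (ENNReal.toReal_pos (hopen.measure_pos _ hne).ne' (measure_ne_top _ _))
    (measureReal_mono (fun z hz => ?_) (measure_ne_top _ _))
  rw [Set.mem_ofPred_eq] at hz ⊢
  exact hz.le

/-- A single tiny P-value makes the Higher Criticism statistic large. -/
lemma sqrt_div_two_le_HCstat {n : ℕ} (X : Fin n → Fin p → ℝ) (hp : 2 ≤ p)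
    (hpos : ∀ j, 0 < pvalue X j) {j : Fin p} (hj : pvalue X j ≤ (p ^ 2 : ℝ)⁻¹) :
    √p / 2 ≤ HCstat X := by
  set i : Fin p := ⟨0, by omega⟩ with hi
  have hle : pvalue X (Tuple.sort (pvalue X) i) ≤ pvalue X j := by
    have := Tuple.monotone_sort (pvalue X) (a := i) (b := (Tuple.sort (pvalue X)).symm j)
      (Fin.mk_le_of_le_val (Nat.zero_le _))
    simpa using this
  refine le_trans ?_ (le_csSup (finite_HC_values _).bddAbove ⟨i, by simpa [hi] using hp, rfl⟩)
  set t := pvalue X (Tuple.sort (pvalue X) i) with ht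
  have ht0 : 0 < t := hpos _
  have hp2 : (2 : ℝ) ≤ p := by exact_mod_cast hp
  have hp0 : (0 : ℝ) < p := by linarith
  have htp := hle.trans hj
  have hinv : (p ^ 2 : ℝ)⁻¹ = (p : ℝ)⁻¹ * (p : ℝ)⁻¹ := by rw [sq, mul_inv]
  have hpi : (p : ℝ)⁻¹ ≤ 1 / 2 := by
    rw [inv_le_comm₀ hp0 (by norm_num)]; norm_num [hp2]
  have hpi0 : 0 < (p : ℝ)⁻¹ := by positivity
  have ht2 : t ≤ (p : ℝ)⁻¹ / 2 := by nlinarith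
  have hs : √(t * (1 - t)) ≤ (p : ℝ)⁻¹ := by
    rw [Real.sqrt_le_left hpi0.le]
    nlinarith
  have hs0 : 0 < √(t * (1 - t)) := Real.sqrt_pos.2 (mul_pos ht0 (by linarith))
  rw [le_div_iff₀ hs0]
  have hnum : (((i : ℕ) : ℝ) + 1) / p = (p : ℝ)⁻¹ := by simp [hi]
  rw [hnum]
  have hsp := Real.sqrt_nonneg (p : ℝ)
  calc √(p : ℝ) / 2 * √(t * (1 - t)) ≤ √(p : ℝ) / 2 * (p : ℝ)⁻¹ := by gcongr
    _ = √(p : ℝ) * ((p : ℝ)⁻¹ / 2) := by ring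
    _ ≤ √(p : ℝ) * ((p : ℝ)⁻¹ - t) := by gcongr; linarith

lemma noiseLaw_col_lt_le {n : ℕ} (hn : 0 < n) {τ : ℝ} (hτ : 0 < τ) {l : Fin n → ℝ}
    (hl : ∀ i, l i ^ 2 = 1) (j : Fin p) :
    (noiseLaw n p).real {Z | ∑ i, (l i * τ + Z i j) ^ 2 < n + n * τ ^ 2 / 2} ≤
      (32 * τ ^ 2 + 8 * sqVar) / (n * (τ ^ 2) ^ 2) := by
  have h := gaussPi_sum_shift_sq_lt hn (s := fun i => l i * τ) (a := τ ^ 2)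
    (fun i => by rw [mul_pow, hl, one_mul]) (by positivity)
  have hm : MeasurableSet {w : Fin n → ℝ | ∑ i, (l i * τ + w i) ^ 2 < n + n * τ ^ 2 / 2} :=
    measurableSet_lt (by fun_prop) measurable_const
  rw [← map_col_noiseLaw (p := p) j, map_measureReal_apply (by fun_prop) hm] at h
  exact h

lemma pi_muLaw_forall_ne_le {ε τ : ℝ} (hτ : τ ≠ 0) (h0 : 0 ≤ ε) (h1 : ε ≤ 1) :
    (Measure.pi fun _ : Fin p => muLaw ε τ).real {μ | ∀ j, μ j ≠ τ} ≤ Real.exp (-(p * ε)) := by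
  have := isProbabilityMeasure_muLaw τ h0 h1
  have hset : {μ : Fin p → ℝ | ∀ j, μ j ≠ τ} = Set.pi Set.univ fun _ => {τ}ᶜ := by
    ext μ; simp
  have hone : (muLaw ε τ) {τ}ᶜ = ENNReal.ofReal (1 - ε) := by
    simp [muLaw, hτ.symm]
  rw [hset, Measure.real, Measure.pi_pi, Finset.prod_const, Finset.card_univ, Fintype.card_fin,
    hone, ENNReal.toReal_pow, ENNReal.toReal_ofReal (by linarith)]
  refine (pow_le_pow_left₀ (by linarith) (Real.one_sub_le_exp_neg ε) p).trans (le_of_eq ?_)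
  rw [← Real.exp_nat_mul]
  congr 1
  ring

lemma jointLaw_dataMap_notMem_rejHC_le {n : ℕ} (hn : 0 < n) (hp : 2 ≤ p) {ε τ : ℝ} (h0 : 0 ≤ ε)
    (h1 : ε ≤ 1) (hτ : 0 < τ) (hτ1 : τ ≤ 1)
    (hlarge : Real.exp (-(n * τ ^ 4 / 32)) ≤ (p ^ 2 : ℝ)⁻¹)
    (hll : 2 * √(2 * Real.log (Real.log p)) ≤ √p / 2) :
    (jointLaw n p ε τ).real {ω | dataMap ω ∉ rejHC} ≤
      Real.exp (-(p * ε)) + (32 * τ ^ 2 + 8 * sqVar) / (n * (τ ^ 2) ^ 2) := by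
  have hn' : (0 : ℝ) < n := by exact_mod_cast hn
  have hmu := isProbabilityMeasure_muLaw τ h0 h1
  have hjoint : IsProbabilityMeasure (jointLaw n p ε τ) := by unfold jointLaw; infer_instance
  set B : Set (Omega n p) := {ω | ∀ j, ∑ i, (dataMap ω i j) ^ 2 < n + n * τ ^ 2 / 2} with hB
  have hBm : MeasurableSet B := by
    rw [hB, Set.ofPred_forall]
    refine MeasurableSet.iInter fun j => measurableSet_lt ?_ measurable_const
    unfold dataMap
    fun_prop
  have hsub : {ω : Omega n p | dataMap ω ∉ rejHC} ⊆ B := by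
    intro ω hω j
    by_contra hj
    refine hω (hll.trans (sqrt_div_two_le_HCstat (dataMap ω) hp (fun _ => chiTail_pos hn _)
      (j := j) ?_))
    rw [pvalue_eq_chiTail]
    have hτ2 : τ ^ 2 ≤ 1 := pow_le_one₀ hτ.le hτ1
    refine (chiTail_antitone n (not_lt.1 hj)).trans ((chiTail_le_exp hn (by positivity) ?_).trans
      (le_trans (le_of_eq ?_) hlarge))
    · nlinarith
    · congr 2
      field_simp
      ring
  refine (measureReal_mono hsub (measure_ne_top _ _)).trans ?_
  have hsv := sqVar_nonneg
  refine (jointLaw_real_le h0 h1 hBm (A := {μ | ∀ j, μ j ≠ τ})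
    (δ := (32 * τ ^ 2 + 8 * sqVar) / (n * (τ ^ 2) ^ 2)) ?_ (by positivity) ?_).trans
    (add_le_add (pi_muLaw_forall_ne_le hτ.ne' h0 h1) le_rfl)
  · rw [Set.ofPred_forall]
    exact MeasurableSet.iInter fun j =>
      (measurableSet_eq_fun (measurable_pi_apply j) measurable_const).compl
  · intro l hl μ hμ
    obtain ⟨j, hj⟩ : ∃ j, μ j = τ := by
      by_contra hne
      exact hμ fun j hj => hne ⟨j, hj⟩
    refine (measureReal_mono (fun Z hZ => ?_) (measure_ne_top _ _)).trans
      (noiseLaw_col_lt_le hn hτ hl j)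
    have := hZ j
    simpa only [dataMap, hj, Set.mem_ofPred_eq] using this

lemma tendsto_natCast_rpow_atTop {c : ℝ} (hc : 0 < c) :
    Tendsto (fun p : ℕ => (p : ℝ) ^ c) atTop atTop :=
  (tendsto_rpow_atTop hc).comp tendsto_natCast_atTop_atTop

lemma eventually_mul_log_le_rpow (C : ℝ) {c : ℝ} (hc : 0 < c) :
    ∀ᶠ p : ℕ in atTop, C * Real.log p ≤ (p : ℝ) ^ c := by
  have h := ((isLittleO_log_rpow_atTop hc).const_mul_left C).bound one_pos
  filter_upwards [tendsto_natCast_atTop_atTop.eventually h] with p hp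
  rw [one_mul, Real.norm_of_nonneg (Real.rpow_nonneg (Nat.cast_nonneg p) c)] at hp
  exact (le_abs_self _).trans hp

lemma rpow_le_nDim (p : ℕ) (θ : ℝ) : (p : ℝ) ^ θ ≤ nDim p θ := Nat.le_ceil _

lemma nDim_pos (θ : ℝ) (hp : 0 < p) : 0 < nDim p θ :=
  Nat.ceil_pos.2 (Real.rpow_pos_of_pos (by exact_mod_cast hp) θ)

theorem tendsto_jointLaw_notMem_rejHC {α β θ : ℝ} (hα0 : 0 < α) (hβ0 : 0 < β) (hβ1 : β < 1)
    (hα : α < θ / 4) :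
    Tendsto (fun p : ℕ => (jointLaw (nDim p θ) p ((p : ℝ) ^ (-β)) ((p : ℝ) ^ (-α))).real
      {ω | dataMap ω ∉ rejHC}) atTop (nhds 0) := by
  have hc : 0 < θ - 4 * α := by linarith
  have hlim : Tendsto (fun p : ℕ => Real.exp (-((p : ℝ) ^ (1 - β))) +
      (32 + 8 * sqVar) / (p : ℝ) ^ (θ - 4 * α)) atTop (nhds 0) := by
    have h1 := Real.tendsto_exp_neg_atTop_nhds_zero.comp
      (tendsto_natCast_rpow_atTop (c := 1 - β) (by linarith))
    have h2 := (tendsto_const_nhds (x := 32 + 8 * sqVar)).div_atTop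
      (tendsto_natCast_rpow_atTop hc)
    simpa using h1.add h2
  refine tendsto_of_tendsto_of_tendsto_of_le_of_le' tendsto_const_nhds hlim
    (Eventually.of_forall fun _ => measureReal_nonneg) ?_
  filter_upwards [eventually_ge_atTop 2, eventually_mul_log_le_rpow 64 hc,
    eventually_mul_log_le_rpow 32 one_pos] with p hp hlog hlog1
  have hp0 : (0 : ℝ) < p := by positivity
  have hp1 : (1 : ℝ) ≤ p := by exact_mod_cast (by omega : 1 ≤ p)
  have hn := nDim_pos θ (p := p) (by omega)
  have hτ : 0 < (p : ℝ) ^ (-α) := Real.rpow_pos_of_pos hp0 _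
  have hτ1 : (p : ℝ) ^ (-α) ≤ 1 := Real.rpow_le_one_of_one_le_of_nonpos hp1 (by linarith)
  have hε1 : (p : ℝ) ^ (-β) ≤ 1 := Real.rpow_le_one_of_one_le_of_nonpos hp1 (by linarith)
  have hnτ : (p : ℝ) ^ (θ - 4 * α) ≤ nDim p θ * ((p : ℝ) ^ (-α)) ^ 4 := by
    have e : (p : ℝ) ^ (θ - 4 * α) = (p : ℝ) ^ θ * ((p : ℝ) ^ (-α)) ^ 4 := by
      rw [← Real.rpow_natCast, ← Real.rpow_mul hp0.le, ← Real.rpow_add hp0]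
      congr 1; push_cast; ring
    rw [e]
    exact mul_le_mul_of_nonneg_right (rpow_le_nDim p θ) (by positivity)
  have hpc : 0 < (p : ℝ) ^ (θ - 4 * α) := Real.rpow_pos_of_pos hp0 _
  have hsv := sqVar_nonneg
  refine (jointLaw_dataMap_notMem_rejHC_le hn hp (Real.rpow_nonneg hp0.le _) hε1 hτ hτ1 ?_
    ?_).trans (add_le_add (le_of_eq ?_) ?_)
  · rw [← Real.exp_log (show (0 : ℝ) < ((p : ℝ) ^ 2)⁻¹ by positivity), Real.exp_le_exp, Real.log_inv,
      Real.log_pow]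
    push_cast
    linarith
  · have hl : 0 ≤ Real.log p := Real.log_nonneg hp1
    have h1 : Real.log (Real.log p) ≤ Real.log p := Real.log_le_self hl
    rw [Real.rpow_one] at hlog1
    have h2 : √(2 * Real.log (Real.log p)) ≤ √(p / 16) := Real.sqrt_le_sqrt (by linarith)
    have h3 : √((p : ℝ) / 16) = √p / 4 := by
      rw [Real.sqrt_div hp0.le, show (16 : ℝ) = 4 ^ 2 by norm_num, Real.sqrt_sq (by norm_num)]
    linarith
  · rw [← Real.rpow_one_add' hp0.le (by linarith)]
    rfl
  · have e : ((p : ℝ) ^ (-α)) ^ 4 = (((p : ℝ) ^ (-α)) ^ 2) ^ 2 := by ring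
    rw [e] at hnτ
    have : ((p : ℝ) ^ (-α)) ^ 2 ≤ 1 := pow_le_one₀ hτ.le hτ1
    gcongr
    linarith

lemma natCast_mul_sum_mean_sq {n : ℕ} (hp : 0 < p) (X : Fin n → Fin p → ℝ) :
    (p : ℝ) * ∑ i, ((p : ℝ)⁻¹ * ∑ j, X i j) ^ 2 = ∑ i, ((√p)⁻¹ * ∑ j, X i j) ^ 2 := by
  have hp' : (0 : ℝ) < p := by exact_mod_cast hp
  rw [Finset.mul_sum]
  refine Finset.sum_congr rfl fun i _ => ?_
  rw [mul_pow, mul_pow, inv_pow, inv_pow, Real.sq_sqrt hp'.le]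
  field_simp

lemma mem_rejSA_iff {n : ℕ} (hn : 0 < n) (hp : 0 < p) (X : Fin n → Fin p → ℝ) :
    X ∈ rejSA ↔
      n + 2 * √(2 * Real.log p) * √(2 * n) ≤ ∑ i, ((√p)⁻¹ * ∑ j, X i j) ^ 2 := by
  have hn' : (0 : ℝ) < n := by exact_mod_cast hn
  rw [rejSA, Set.mem_ofPred_eq, natCast_mul_sum_mean_sq hp, le_div_iff₀ (by positivity),
    le_sub_iff_add_le, add_comm]

lemma noiseLaw_rejSA_le {n : ℕ} (hn : 0 < n) (hp : 1 < p) :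
    (noiseLaw n p).real rejSA ≤ sqVar / (8 * Real.log p) := by
  have hn' : (0 : ℝ) < n := by exact_mod_cast hn
  have hlog : 0 < Real.log p := Real.log_pos (by exact_mod_cast hp)
  have h := gaussPi_le_abs_sum_shift_sq_sub (n := n) (s := fun _ => 0) (a := 0)
    (u := 2 * √(2 * Real.log p) * √(2 * n)) (fun _ => by simp) (by positivity)
  have hm : MeasurableSet {w : Fin n → ℝ | 2 * √(2 * Real.log p) * √(2 * n) ≤
      |∑ i, (0 + w i) ^ 2 - (n : ℝ) * (1 + 0)|} := measurableSet_le measurable_const (by fun_prop)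
  rw [← map_normalized_row_sum_noiseLaw n (p := p) (by omega),
    map_measureReal_apply (by fun_prop) hm] at h
  refine (measureReal_mono (fun X hX => ?_) (measure_ne_top _ _)).trans (h.trans (le_of_eq ?_))
  · rw [mem_rejSA_iff hn (by omega)] at hX
    rw [Set.mem_preimage, Set.mem_ofPred_eq]
    refine le_trans ?_ (le_abs_self _)
    simp only [zero_add, add_zero, mul_one]
    linarith
  · rw [mul_pow, mul_pow, Real.sq_sqrt (by positivity), Real.sq_sqrt (by positivity)]
    field_simp
    ring

lemma pi_muLaw_sum_lt_le (hp : 0 < p) {ε τ : ℝ} (hτ : 0 < τ) (h0 : 0 < ε) (h1 : ε ≤ 1) :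
    (Measure.pi fun _ : Fin p => muLaw ε τ).real {μ | ∑ j, μ j < p * (ε * τ) / 2} ≤
      4 / (p * ε) := by
  have := isProbabilityMeasure_muLaw τ h0.le h1
  have hp' : (0 : ℝ) < p := by exact_mod_cast hp
  have hint : ∀ f : ℝ → ℝ, Integrable f (muLaw ε τ) := fun f =>
    ((integrable_dirac (by simp)).smul_measure ENNReal.ofReal_ne_top).add_measure
      ((integrable_dirac (by simp)).smul_measure ENNReal.ofReal_ne_top)
  have hI : ∀ f : ℝ → ℝ, ∫ x, f x ∂muLaw ε τ = (1 - ε) * f 0 + ε * f τ := fun f => by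
    rw [muLaw, integral_add_measure
      ((integrable_dirac (by simp)).smul_measure ENNReal.ofReal_ne_top)
      ((integrable_dirac (by simp)).smul_measure ENNReal.ofReal_ne_top),
      integral_smul_measure, integral_smul_measure, integral_dirac, integral_dirac,
      ENNReal.toReal_ofReal h0.le, ENNReal.toReal_ofReal (by linarith)]
    rfl
  have hmem : MemLp (fun x : ℝ => x) 2 (muLaw ε τ) :=
    (memLp_two_iff_integrable_sq (by fun_prop)).2 (hint _)
  have hmean : ∫ x, x ∂muLaw ε τ = ε * τ := by rw [hI fun x => x]; ring
  have hvar : Var[fun x : ℝ => x; muLaw ε τ] ≤ ε * τ ^ 2 := by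
    rw [variance_eq_integral (by fun_prop), hmean, hI]
    nlinarith [sq_nonneg (ε * τ)]
  have h := measureReal_pi_le_abs_sum_sub (n := p) (muLaw ε τ) (f := fun _ x => x)
    (u := p * (ε * τ) / 2) (fun _ => hmem) (fun _ => hmean) (fun _ => hvar) (by positivity)
  refine (measureReal_mono (fun μ hμ => ?_) (measure_ne_top _ _)).trans (h.trans (le_of_eq ?_))
  · rw [Set.mem_ofPred_eq] at hμ ⊢
    refine le_trans ?_ (neg_le_abs _)
    linarith
  · field_simp
    ring

lemma jointLaw_dataMap_notMem_rejSA_le {n : ℕ} (hn : 0 < n) (hp : 0 < p) {ε τ : ℝ} (h0 : 0 < ε)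
    (h1 : ε ≤ 1) (hτ : 0 < τ)
    (hlarge : 2 * √(2 * Real.log p) * √(2 * n) ≤ n * (p * (ε * τ) ^ 2 / 4) / 2) :
    (jointLaw n p ε τ).real {ω | dataMap ω ∉ rejSA} ≤ 4 / (p * ε) +
      (32 * (p * (ε * τ) ^ 2 / 4) + 8 * sqVar) / (n * (p * (ε * τ) ^ 2 / 4) ^ 2) := by
  have hn' : (0 : ℝ) < n := by exact_mod_cast hn
  have hp' : (0 : ℝ) < p := by exact_mod_cast hp
  have hsv := sqVar_nonneg
  set a₀ := p * (ε * τ) ^ 2 / 4 with ha₀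
  have ha₀0 : 0 < a₀ := by positivity
  have hB : {ω : Omega n p | dataMap ω ∉ rejSA} = {ω | ∑ i, ((√p)⁻¹ * ∑ j, dataMap ω i j) ^ 2 <
      n + 2 * √(2 * Real.log p) * √(2 * n)} := by
    ext ω
    rw [Set.mem_ofPred_eq, Set.mem_ofPred_eq, mem_rejSA_iff hn hp, not_le]
  have hBm : MeasurableSet {ω : Omega n p | dataMap ω ∉ rejSA} := by
    rw [hB]
    refine measurableSet_lt ?_ measurable_const
    unfold dataMap
    fun_prop
  refine (jointLaw_real_le h0.le h1 hBm (A := {μ | ∑ j, μ j < p * (ε * τ) / 2})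
    (δ := (32 * a₀ + 8 * sqVar) / (n * a₀ ^ 2)) (measurableSet_lt (by fun_prop) measurable_const)
    (by positivity) ?_).trans (add_le_add (pi_muLaw_sum_lt_le hp hτ h0 h1) le_rfl)
  intro l hl μ hμ
  rw [Set.mem_ofPred_eq, not_lt] at hμ
  set b := (√p)⁻¹ * ∑ j, μ j with hb
  have hab : a₀ ≤ b ^ 2 := by
    rw [hb, mul_pow, inv_pow, Real.sq_sqrt hp'.le, ← div_eq_inv_mul, le_div_iff₀ hp']
    have : (p * (ε * τ) / 2) ^ 2 ≤ (∑ j, μ j) ^ 2 := pow_le_pow_left₀ (by positivity) hμ 2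
    rw [ha₀]
    linarith
  have hb0 : 0 < b ^ 2 := ha₀0.trans_le hab
  have h := gaussPi_sum_shift_sq_lt hn (s := fun i => l i * b) (a := b ^ 2)
    (fun i => by rw [mul_pow, hl, one_mul]) hb0
  have hm : MeasurableSet {w : Fin n → ℝ | ∑ i, (l i * b + w i) ^ 2 < n + n * b ^ 2 / 2} :=
    measurableSet_lt (by fun_prop) measurable_const
  rw [← map_normalized_row_sum_noiseLaw n hp, map_measureReal_apply (by fun_prop) hm] at h
  refine (measureReal_mono (fun Z hZ => ?_) (measure_ne_top _ _)).trans (h.trans ?_)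
  · have hZ' : (l, μ, Z) ∈ {ω : Omega n p | dataMap ω ∉ rejSA} := hZ
    rw [hB, Set.mem_ofPred_eq] at hZ'
    rw [Set.mem_preimage, Set.mem_ofPred_eq]
    have e : ∀ i, (√p)⁻¹ * ∑ j, dataMap (l, μ, Z) i j = l i * b + (√p)⁻¹ * ∑ j, Z i j := by
      intro i
      simp only [dataMap, Finset.sum_add_distrib, ← Finset.mul_sum]
      rw [hb]; ring
    simp_rw [e] at hZ'
    have : n * a₀ ≤ n * b ^ 2 := mul_le_mul_of_nonneg_left hab hn'.le
    linarith
  · have h1 : ∀ a : ℝ, 0 < a → (32 * a + 8 * sqVar) / (n * a ^ 2) =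
        32 / (n * a) + 8 * sqVar / (n * a ^ 2) := fun a ha => by
      field_simp
    rw [h1 _ hb0, h1 _ ha₀0]
    gcongr

theorem tendsto_noiseLaw_rejSA (θ : ℝ) :
    Tendsto (fun p : ℕ => (noiseLaw (nDim p θ) p).real rejSA) atTop (nhds 0) := by
  have hlog : Tendsto (fun p : ℕ => Real.log p) atTop atTop :=
    Real.tendsto_log_atTop.comp tendsto_natCast_atTop_atTop
  refine tendsto_of_tendsto_of_tendsto_of_le_of_le' tendsto_const_nhds
    ((tendsto_const_nhds (x := sqVar)).div_atTop (hlog.const_mul_atTop (by norm_num : (0 : ℝ) < 8)))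
    (Eventually.of_forall fun _ => measureReal_nonneg) ?_
  filter_upwards [eventually_gt_atTop 1] with p hp
  exact noiseLaw_rejSA_le (nDim_pos θ (by omega)) hp

theorem tendsto_jointLaw_notMem_rejSA {α β θ : ℝ} (hβ0 : 0 < β) (hβ1 : β < 1)
    (hα : α < etaHyp1 θ β) :
    Tendsto (fun p : ℕ => (jointLaw (nDim p θ) p ((p : ℝ) ^ (-β)) ((p : ℝ) ^ (-α))).real
      {ω | dataMap ω ∉ rejSA}) atTop (nhds 0) := by
  set c : ℝ := θ / 2 + (1 - 2 * β - 2 * α) with hc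
  have hc0 : 0 < c := by
    rw [etaHyp1] at hα
    rw [hc]; linarith
  have hlim : Tendsto (fun p : ℕ => 4 / (p : ℝ) ^ (1 - β) +
      (128 / (p : ℝ) ^ c + 128 * sqVar / ((p : ℝ) ^ c) ^ 2)) atTop (nhds 0) := by
    have h1 := (tendsto_const_nhds (x := (4 : ℝ))).div_atTop
      (tendsto_natCast_rpow_atTop (c := 1 - β) (by linarith))
    have h2 := (tendsto_const_nhds (x := (128 : ℝ))).div_atTop (tendsto_natCast_rpow_atTop hc0)
    have h3 := (tendsto_const_nhds (x := 128 * sqVar)).div_atTop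
      ((tendsto_pow_atTop two_ne_zero).comp (tendsto_natCast_rpow_atTop hc0))
    simpa using h1.add (h2.add h3)
  refine tendsto_of_tendsto_of_tendsto_of_le_of_le' tendsto_const_nhds hlim
    (Eventually.of_forall fun _ => measureReal_nonneg) ?_
  filter_upwards [eventually_ge_atTop 2,
    eventually_mul_log_le_rpow 1024 (c := 2 * c) (by linarith)] with p hp hlog
  have hp0 : (0 : ℝ) < p := by positivity
  have hp1 : (1 : ℝ) ≤ p := by exact_mod_cast (by omega : 1 ≤ p)
  have hn := nDim_pos θ (p := p) (by omega)
  have hnθ := rpow_le_nDim p θ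
  have hn1 : (1 : ℝ) ≤ nDim p θ := by exact_mod_cast hn
  have hε0 : 0 < (p : ℝ) ^ (-β) := Real.rpow_pos_of_pos hp0 _
  have hτ : 0 < (p : ℝ) ^ (-α) := Real.rpow_pos_of_pos hp0 _
  have hε1 : (p : ℝ) ^ (-β) ≤ 1 := Real.rpow_le_one_of_one_le_of_nonpos hp1 (by linarith)
  have hl : 0 ≤ Real.log p := Real.log_nonneg hp1
  have hq : (p : ℝ) * ((p : ℝ) ^ (-β) * (p : ℝ) ^ (-α)) ^ 2 = (p : ℝ) ^ (1 - 2 * β - 2 * α) := by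
    rw [← Real.rpow_add hp0, ← Real.rpow_natCast, ← Real.rpow_mul hp0.le]
    nth_rewrite 1 [← Real.rpow_one (p : ℝ)]
    rw [← Real.rpow_add hp0]
    congr 1; push_cast; ring
  have hpε : (p : ℝ) * (p : ℝ) ^ (-β) = (p : ℝ) ^ (1 - β) := by
    nth_rewrite 1 [← Real.rpow_one (p : ℝ)]
    rw [← Real.rpow_add hp0]
    rfl
  have hq0 : 0 < (p : ℝ) ^ (1 - 2 * β - 2 * α) := Real.rpow_pos_of_pos hp0 _
  have hpc0 : 0 < (p : ℝ) ^ c := Real.rpow_pos_of_pos hp0 _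
  have hsv := sqVar_nonneg
  have hsn1 : 1 ≤ √(nDim p θ : ℝ) := Real.one_le_sqrt.2 hn1
  have hsn : √(nDim p θ : ℝ) ^ 2 = nDim p θ := Real.sq_sqrt (by positivity)
  have hqc : (p : ℝ) ^ c ≤ √(nDim p θ) * (p : ℝ) ^ (1 - 2 * β - 2 * α) := by
    rw [hc, Real.rpow_add hp0]
    refine mul_le_mul_of_nonneg_right (Real.le_sqrt_of_sq_le ?_) hq0.le
    rw [← Real.rpow_natCast, ← Real.rpow_mul hp0.le]
    convert hnθ using 2
    push_cast; ring
  have hbound := jointLaw_dataMap_notMem_rejSA_le (n := nDim p θ) hn (by omega : 0 < p) hε0 hε1 hτ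
  rw [hq, hpε] at hbound
  set N : ℝ := (nDim p θ : ℝ) with hN
  set q := (p : ℝ) ^ (1 - 2 * β - 2 * α) with hqd
  refine (hbound ?_).trans (add_le_add le_rfl ?_)
  · have h1 : 32 * √(Real.log p) ≤ (p : ℝ) ^ c := by
      refine (sq_le_sq₀ (by positivity) hpc0.le).1 ?_
      have e : ((p : ℝ) ^ c) ^ 2 = (p : ℝ) ^ (2 * c) := by
        rw [← Real.rpow_natCast, ← Real.rpow_mul hp0.le]
        congr 1; push_cast; ring
      rw [mul_pow, Real.sq_sqrt hl, e]
      linarith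
    rw [Real.sqrt_mul zero_le_two, Real.sqrt_mul zero_le_two]
    have h2 : √2 * √2 = (2 : ℝ) := Real.mul_self_sqrt zero_le_two
    have h3 : 2 * (√2 * √(Real.log p)) * (√2 * √N) = 4 * √(Real.log p) * √N := by
      linear_combination (2 * √(Real.log p) * √N) * h2
    have h4 : N * (q / 4) / 2 = √N * (√N * q) / 8 := by
      linear_combination (-q / 8) * hsn
    rw [h3, h4]
    have h5 := mul_le_mul_of_nonneg_left (h1.trans hqc) (Real.sqrt_nonneg N)
    linarith
  · have hN0 : 0 < N := by linarith
    have e : (32 * (q / 4) + 8 * sqVar) / (N * (q / 4) ^ 2) =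
        128 / (√N * (√N * q)) + 128 * sqVar / (√N * q) ^ 2 := by
      have : √N * (√N * q) = N * q := by rw [← mul_assoc, ← sq, hsn]
      rw [this, mul_pow, hsn]
      field_simp
      ring
    rw [e]
    have h6 : (p : ℝ) ^ c ≤ √N * (√N * q) :=
      hqc.trans (le_mul_of_one_le_left (by positivity) hsn1)
    gcongr

end

end ARWPaper

open ARWPaper Filter in
/-- CTUB for global hypothesis testing. If `α < η̃^hyp_θ(β)` then
(i) the Simple Aggregation test succeeds when `0 < β < 1/2`, and (ii) the Higher
Criticism test succeeds when `1/2 < β < 1`. -/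
theorem hypothesis_testing_ctub
    (α β θ : ℝ) (hα0 : 0 < α) (hα1 : α < 1) (hβ0 : 0 < β) (hβ1 : β < 1)
    (hθ0 : 0 < θ) (hθ1 : θ < 1) (hmain : α < etaHypT θ β) :
    (β < 1 / 2 →
      Tendsto
        (fun p : ℕ => testErr (nDim p θ) p ((p : ℝ) ^ (-β)) ((p : ℝ) ^ (-α)) rejSA)
        atTop (nhds 0)) ∧
    (1 / 2 < β →
      Tendsto
        (fun p : ℕ => testErr (nDim p θ) p ((p : ℝ) ^ (-β)) ((p : ℝ) ^ (-α)) rejHC)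
        atTop (nhds 0)) := by
  refine ⟨fun hβ => ?_, fun hβ => ?_⟩
  · have hα : α < etaHyp1 θ β := by
      rw [etaHypT, max_eq_left (by rw [etaHyp1]; linarith)] at hmain
      exact hmain
    simpa [testErr, Measure.real] using (tendsto_noiseLaw_rejSA θ).add
      (tendsto_jointLaw_notMem_rejSA hβ0 hβ1 hα)
  · have hα : α < θ / 4 := by
      rw [etaHypT, max_eq_right (by rw [etaHyp1]; linarith)] at hmain
      exact hmain
    simpa [testErr, Measure.real] using (tendsto_noiseLaw_rejHC fun p => nDim p θ).add
      (tendsto_jointLaw_notMem_rejHC hα0 hβ0 hβ1 hα)
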